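/- arXiv:1509.08956 — 10 statements merged into one kernel-verified Lean document; each statement's English description precedes it below -/
import Mathlib

section
/- For every nonzero θ ∈ F and every t ∈ ℤ, there is an F-algebra isomorphism from U_eq to U_q(sl2) sending x ↦ k⁻¹ − k^{−1−t} e q^{1+t}(q − q⁻¹)θ⁻¹, y^{±1} ↦ k^{±1}, z ↦ k⁻¹ + f k^{t} q^{−t}(q − q⁻¹)θ; its inverse sends e ↦ y^{t}(1 − yx) q^{−1−t}(q − q⁻¹)⁻¹ θ, f ↦ (z − y⁻¹) y^{−t} q^{t}(q − q⁻¹)⁻¹ θ⁻¹, k^{±1} ↦ y^{±1}. -/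
namespace Lusztig

variable (F : Type*) [Field F] (q : F)



/-- Chevalley relations; generators: 0 = e, 1 = f, 2 = k, 3 = k⁻¹. -/
inductive ChevRel : FreeAlgebra F (Fin 4) → FreeAlgebra F (Fin 4) → Prop
  | kki : ChevRel (FreeAlgebra.ι F 2 * FreeAlgebra.ι F 3) 1
  | kik : ChevRel (FreeAlgebra.ι F 3 * FreeAlgebra.ι F 2) 1
  | ke : ChevRel (FreeAlgebra.ι F 2 * FreeAlgebra.ι F 0)
      ((q ^ 2) • (FreeAlgebra.ι F 0 * FreeAlgebra.ι F 2))
  | kf : ChevRel (FreeAlgebra.ι F 2 * FreeAlgebra.ι F 1)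
      ((q⁻¹ ^ 2) • (FreeAlgebra.ι F 1 * FreeAlgebra.ι F 2))
  | ef : ChevRel (FreeAlgebra.ι F 0 * FreeAlgebra.ι F 1 - FreeAlgebra.ι F 1 * FreeAlgebra.ι F 0)
      (((q - q⁻¹)⁻¹) • (FreeAlgebra.ι F 2 - FreeAlgebra.ι F 3))

/-- The quantum algebra U_q(sl2) in the Chevalley presentation. -/
abbrev Uq := RingQuot (ChevRel F q)

noncomputable def ue : Uq F q := RingQuot.mkAlgHom F (ChevRel F q) (FreeAlgebra.ι F 0)
noncomputable def uf : Uq F q := RingQuot.mkAlgHom F (ChevRel F q) (FreeAlgebra.ι F 1)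
noncomputable def uk : Uq F q := RingQuot.mkAlgHom F (ChevRel F q) (FreeAlgebra.ι F 2)
noncomputable def uki : Uq F q := RingQuot.mkAlgHom F (ChevRel F q) (FreeAlgebra.ι F 3)

/-- k as a unit of U_q(sl2), with inverse k⁻¹. -/
noncomputable def kU : (Uq F q)ˣ where
  val := uk F q
  inv := uki F q
  val_inv := by
    have h := RingQuot.mkAlgHom_rel F (ChevRel.kki (F := F) (q := q))
    simpa [uk, uki, map_mul, map_one] using h
  inv_val := by
    have h := RingQuot.mkAlgHom_rel F (ChevRel.kik (F := F) (q := q))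
    simpa [uk, uki, map_mul, map_one] using h




/-- Equitable relations; generators: 0 = x, 1 = y, 2 = y⁻¹, 3 = z. -/
inductive EqRel : FreeAlgebra F (Fin 4) → FreeAlgebra F (Fin 4) → Prop
  | yyi : EqRel (FreeAlgebra.ι F 1 * FreeAlgebra.ι F 2) 1
  | yiy : EqRel (FreeAlgebra.ι F 2 * FreeAlgebra.ι F 1) 1
  | xy : EqRel (((q - q⁻¹)⁻¹) •
      (q • (FreeAlgebra.ι F 0 * FreeAlgebra.ι F 1) - q⁻¹ • (FreeAlgebra.ι F 1 * FreeAlgebra.ι F 0))) 1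
  | yz : EqRel (((q - q⁻¹)⁻¹) •
      (q • (FreeAlgebra.ι F 1 * FreeAlgebra.ι F 3) - q⁻¹ • (FreeAlgebra.ι F 3 * FreeAlgebra.ι F 1))) 1
  | zx : EqRel (((q - q⁻¹)⁻¹) •
      (q • (FreeAlgebra.ι F 3 * FreeAlgebra.ι F 0) - q⁻¹ • (FreeAlgebra.ι F 0 * FreeAlgebra.ι F 3))) 1

/-- The quantum algebra U_q(sl2) in the equitable presentation. -/
abbrev Ueq := RingQuot (EqRel F q)

noncomputable def ux : Ueq F q := RingQuot.mkAlgHom F (EqRel F q) (FreeAlgebra.ι F 0)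
noncomputable def uy : Ueq F q := RingQuot.mkAlgHom F (EqRel F q) (FreeAlgebra.ι F 1)
noncomputable def uyi : Ueq F q := RingQuot.mkAlgHom F (EqRel F q) (FreeAlgebra.ι F 2)
noncomputable def uz : Ueq F q := RingQuot.mkAlgHom F (EqRel F q) (FreeAlgebra.ι F 3)

/-- y as a unit of U_eq, with inverse y⁻¹. -/
noncomputable def yU : (Ueq F q)ˣ where
  val := uy F q
  inv := uyi F q
  val_inv := by
    have h := RingQuot.mkAlgHom_rel F (EqRel.yyi (F := F) (q := q))
    simpa [uy, uyi, map_mul, map_one] using h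
  inv_val := by
    have h := RingQuot.mkAlgHom_rel F (EqRel.yiy (F := F) (q := q))
    simpa [uy, uyi, map_mul, map_one] using h



set_option linter.unusedSimpArgs false

section helpers
variable {F} {q} {A : Type*} [Ring A] [Algebra F A]

lemma zpow_comm_smul (u : Aˣ) (a : A) (s : F) (hs : s ≠ 0)
    (h : (u : A) * a = s • (a * (u : A))) (n : ℤ) :
    ((u ^ n : Aˣ) : A) * a = (s ^ n) • (a * ((u ^ n : Aˣ) : A)) := by
  have hi : ((u⁻¹ : Aˣ) : A) * a = s⁻¹ • (a * ((u⁻¹ : Aˣ) : A)) := by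
    have h2 : a * ((u⁻¹ : Aˣ) : A) = s • (((u⁻¹ : Aˣ) : A) * a) := by
      calc a * ((u⁻¹ : Aˣ) : A) = ((u⁻¹ : Aˣ) : A) * ((u : A) * a) * ((u⁻¹ : Aˣ) : A) := by
            rw [Units.inv_mul_cancel_left]
        _ = _ := by rw [h]; simp [mul_assoc]
    rw [h2, smul_smul, inv_mul_cancel₀ hs, one_smul]
  induction n using Int.induction_on with
  | zero => simp
  | succ n ih =>
    rw [zpow_add_one, Units.val_mul, mul_assoc, h, mul_smul_comm, ← mul_assoc, ih, zpow_add_one₀ hs]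
    simp only [smul_mul_assoc, mul_assoc, smul_smul]
    rw [mul_comm s]
  | pred n ih =>
    rw [zpow_sub_one, Units.val_mul, mul_assoc, hi, mul_smul_comm, ← mul_assoc, ih, zpow_sub_one₀ hs]
    simp only [smul_mul_assoc, mul_assoc, smul_smul]
    rw [mul_comm s⁻¹]

lemma assoc_rule {a b : A} {s : F} (h : a * b = s • (b * a)) (w : A) :
    a * (b * w) = s • (b * (a * w)) := by
  rw [← mul_assoc, h, smul_mul_assoc, mul_assoc]

lemma inv_rule (u : Aˣ) (a : A) (s : F) (hs : s ≠ 0)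
    (h : (u : A) * a = s • (a * (u : A))) :
    ((u⁻¹ : Aˣ) : A) * a = s⁻¹ • (a * ((u⁻¹ : Aˣ) : A)) := by
  simpa using zpow_comm_smul u a s hs h (-1)

/-- forward relations -/
lemma fwd (k K : Aˣ) (e f : A) (r θ : F) (hq : q ≠ 0) (hd : q - q⁻¹ ≠ 0) (hr : r ≠ 0) (hθ : θ ≠ 0)
    (hK : K * k = k * K)
    (hke : (k : A) * e = (q ^ 2) • (e * (k : A)))
    (hkf : (k : A) * f = (q⁻¹ ^ 2) • (f * (k : A)))
    (hKe : (K : A) * e = (r ^ 2) • (e * (K : A)))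
    (hKf : (K : A) * f = (r⁻¹ ^ 2) • (f * (K : A)))
    (hef : e * f - f * e = ((q - q⁻¹)⁻¹) • ((k : A) - ((k⁻¹ : Aˣ) : A)))
    (x z : A)
    (hx : x = ((k⁻¹ : Aˣ) : A) - (q * r * (q - q⁻¹) * θ⁻¹) •
      (((k⁻¹ : Aˣ) : A) * ((K⁻¹ : Aˣ) : A) * e))
    (hz : z = ((k⁻¹ : Aˣ) : A) + (r⁻¹ * (q - q⁻¹) * θ) • (f * (K : A))) :
    (((q - q⁻¹)⁻¹) • (q • (x * k) - q⁻¹ • (k * x)) = 1) ∧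
    (((q - q⁻¹)⁻¹) • (q • (k * z) - q⁻¹ • (z * k)) = 1) ∧
    (((q - q⁻¹)⁻¹) • (q • (z * x) - q⁻¹ • (x * z)) = 1) := by
  have hke' := inv_rule k e _ (by positivity) hke
  have hkf' := inv_rule k f _ (by positivity) hkf
  have hKe' := inv_rule K e _ (by positivity) hKe
  have hKf' := inv_rule K f _ (by positivity) hKf
  have c1 : (K : A) * k = k * K := by exact_mod_cast congrArg Units.val hK
  have hc : Commute K k := hK
  have c2 : (K : A) * (k⁻¹ : Aˣ) = (k⁻¹ : Aˣ) * K := by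
    exact_mod_cast congrArg Units.val hc.inv_right.eq
  have c3 : ((K⁻¹ : Aˣ) : A) * k = k * (K⁻¹ : Aˣ) := by
    exact_mod_cast congrArg Units.val hc.inv_left.eq
  have c4 : ((K⁻¹ : Aˣ) : A) * (k⁻¹ : Aˣ) = (k⁻¹ : Aˣ) * (K⁻¹ : Aˣ) := by
    exact_mod_cast congrArg Units.val hc.inv_inv.eq
  have a1 (w : A) : (K : A) * (k * w) = k * (K * w) := by rw [← mul_assoc, c1, mul_assoc]
  have a2 (w : A) : (K : A) * ((k⁻¹ : Aˣ) * w) = (k⁻¹ : Aˣ) * (K * w) := by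
    rw [← mul_assoc, c2, mul_assoc]
  have a3 (w : A) : ((K⁻¹ : Aˣ) : A) * (k * w) = k * ((K⁻¹ : Aˣ) * w) := by
    rw [← mul_assoc, c3, mul_assoc]
  have a4 (w : A) : ((K⁻¹ : Aˣ) : A) * ((k⁻¹ : Aˣ) * w) = (k⁻¹ : Aˣ) * ((K⁻¹ : Aˣ) * w) := by
    rw [← mul_assoc, c4, mul_assoc]
  have hef1 : e * f = f * e + ((q - q⁻¹)⁻¹) • ((k : A) - ((k⁻¹ : Aˣ) : A)) := by
    rw [← hef]; abel
  have hef2 (w : A) : e * (f * w) = f * (e * w) +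
      ((q - q⁻¹)⁻¹) • ((k : A) * w - ((k⁻¹ : Aˣ) : A) * w) := by
    rw [← mul_assoc, hef1]; simp only [add_mul, sub_mul, smul_mul_assoc, mul_assoc]
  subst hx hz
  have hd' : q ^ 2 - 1 ≠ 0 := by
    intro h; apply hd; field_simp; simpa using h
  refine ⟨?_, ?_, ?_⟩ <;>
  · simp only [mul_add, add_mul, mul_sub, sub_mul, smul_mul_assoc, mul_smul_comm, mul_assoc,
      hke, assoc_rule hke, hkf, assoc_rule hkf, hKe, assoc_rule hKe, hKf, assoc_rule hKf,
      hke', assoc_rule hke', hkf', assoc_rule hkf', hKe', assoc_rule hKe', hKf', assoc_rule hKf',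
      c1, c2, c3, c4, a1, a2, a3, a4, hef1, hef2, Units.mul_inv, Units.inv_mul,
      Units.mul_inv_cancel_left, Units.inv_mul_cancel_left, mul_one]
    match_scalars <;> field_simp <;> ring

/-- backward relations -/
lemma bwd (k K : Aˣ) (x z : A) (r θ : F) (hq : q ≠ 0) (hd : q - q⁻¹ ≠ 0) (hr : r ≠ 0) (hθ : θ ≠ 0)
    (hK : K * k = k * K)
    (hKe : (k : A) * (1 - k * x) = (q ^ 2) • ((1 - k * x) * (k : A)) →
      (K : A) * (1 - k * x) = (r ^ 2) • ((1 - k * x) * (K : A)))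
    (hKf : (k : A) * (z - (k⁻¹ : Aˣ)) = (q⁻¹ ^ 2) • ((z - (k⁻¹ : Aˣ)) * (k : A)) →
      (K : A) * (z - (k⁻¹ : Aˣ)) = (r⁻¹ ^ 2) • ((z - (k⁻¹ : Aˣ)) * (K : A)))
    (hxy : ((q - q⁻¹)⁻¹) • (q • (x * k) - q⁻¹ • (k * x)) = 1)
    (hyz : ((q - q⁻¹)⁻¹) • (q • (k * z) - q⁻¹ • (z * k)) = 1)
    (hzx : ((q - q⁻¹)⁻¹) • (q • (z * x) - q⁻¹ • (x * z)) = 1)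
    (e f : A)
    (he : e = (q⁻¹ * r⁻¹ * (q - q⁻¹)⁻¹ * θ) • ((K : A) * (1 - k * x)))
    (hf : f = (r * (q - q⁻¹)⁻¹ * θ⁻¹) • ((z - (k⁻¹ : Aˣ)) * ((K⁻¹ : Aˣ) : A))) :
    ((k : A) * e = (q ^ 2) • (e * (k : A))) ∧
    ((k : A) * f = (q⁻¹ ^ 2) • (f * (k : A))) ∧
    (e * f - f * e = ((q - q⁻¹)⁻¹) • ((k : A) - ((k⁻¹ : Aˣ) : A))) := by
  have hd' : q ^ 2 - 1 ≠ 0 := by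
    intro h; apply hd; field_simp; simpa using h
  have hxy1 : (k : A) * x = (q ^ 2) • (x * k) - (q ^ 2 - 1) • (1 : A) := by
    rw [← hxy]; match_scalars <;> field_simp <;> ring
  have hyz1 : z * (k : A) = (q ^ 2) • (k * z) - (q ^ 2 - 1) • (1 : A) := by
    rw [← hyz]; match_scalars <;> field_simp <;> ring
  have hzx1 : x * z = (q ^ 2) • (z * x) - (q ^ 2 - 1) • (1 : A) := by
    rw [← hzx]; match_scalars <;> field_simp <;> ring
  have hne : (k : A) * (1 - k * x) = (q ^ 2) • ((1 - k * x) * (k : A)) := by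
    have : (k : A) * (k * x) = (q ^ 2) • (k * (x * k)) - (q ^ 2 - 1) • (k : A) := by
      conv_lhs => rw [hxy1]
      simp [mul_sub]
    simp only [mul_sub, sub_mul, this, mul_assoc, mul_one, one_mul]
    match_scalars <;> ring
  have hmf : (k : A) * (z - (k⁻¹ : Aˣ)) = (q⁻¹ ^ 2) • ((z - (k⁻¹ : Aˣ)) * (k : A)) := by
    simp only [mul_sub, sub_mul, hyz1, Units.mul_inv, Units.inv_mul]
    match_scalars <;> field_simp <;> ring
  have hnm : (1 - k * x) * (z - (k⁻¹ : Aˣ)) - (z - (k⁻¹ : Aˣ)) * (1 - k * x) =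
      (q ^ 2 - 1) • ((k : A) - ((k⁻¹ : Aˣ) : A)) := by
    have h1 : (k : A) * (x * (k⁻¹ : Aˣ)) = (q ^ 2) • x - (q ^ 2 - 1) • ((k⁻¹ : Aˣ) : A) := by
      rw [← mul_assoc, hxy1]; simp [sub_mul, mul_assoc]
    have h2 : z * ((k : A) * x) = (q ^ 2) • (k * (z * x)) - (q ^ 2 - 1) • x := by
      rw [← mul_assoc, hyz1]; simp [sub_mul, mul_assoc]
    have h3 : (k : A) * (x * z) = (q ^ 2) • (k * (z * x)) - (q ^ 2 - 1) • (k : A) := by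
      rw [hzx1]; simp [mul_sub]
    simp only [mul_sub, sub_mul, mul_assoc, h1, h2, h3, mul_one, one_mul,
      Units.inv_mul_cancel_left]
    match_scalars <;> ring
  specialize hKe hne
  specialize hKf hmf
  generalize (1 - (k : A) * x) = n at *
  generalize (z - ((k⁻¹ : Aˣ) : A)) = m at *
  have hKe' := inv_rule K n _ (by positivity) hKe
  have hKf' := inv_rule K m _ (by positivity) hKf
  have hc : Commute K k := hK
  have c1 : (K : A) * k = k * K := by exact_mod_cast congrArg Units.val hK
  have c3 : ((K⁻¹ : Aˣ) : A) * k = k * (K⁻¹ : Aˣ) := by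
    exact_mod_cast congrArg Units.val hc.inv_left.eq
  have hnm1 : n * m = m * n + (q ^ 2 - 1) • ((k : A) - ((k⁻¹ : Aˣ) : A)) := by
    rw [← hnm]; abel
  subst he hf
  refine ⟨?_, ?_, ?_⟩ <;>
  · simp only [mul_add, add_mul, mul_sub, sub_mul, smul_mul_assoc, mul_smul_comm, mul_assoc,
      hne, assoc_rule hne, hmf, assoc_rule hmf, hKe, assoc_rule hKe, hKf, assoc_rule hKf,
      hKe', assoc_rule hKe', hKf', assoc_rule hKf',
      c1, c3, hnm1, Units.mul_inv, Units.inv_mul,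
      Units.mul_inv_cancel_left, Units.inv_mul_cancel_left, mul_one]
    match_scalars <;> field_simp <;> ring

end helpers

/-- the primary identification of type (θ, t): an F-algebra isomorphism
from the equitable presentation to the Chevalley presentation, with the indicated action
on generators, and whose inverse has the indicated action on generators. -/
theorem stmt0 (hq : q ≠ 0) (hroot : ∀ n : ℕ, 0 < n → q ^ n ≠ 1)
    (θ : F) (hθ : θ ≠ 0) (t : ℤ) :
    ∃ φ : Ueq F q ≃ₐ[F] Uq F q,
      φ (ux F q) = uki F q -
        (q ^ (1 + t) * (q - q⁻¹) * θ⁻¹) • (((kU F q ^ (-1 - t) : (Uq F q)ˣ) : Uq F q) * ue F q) ∧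
      φ (uy F q) = uk F q ∧
      φ (uyi F q) = uki F q ∧
      φ (uz F q) = uki F q +
        (q ^ (-t) * (q - q⁻¹) * θ) • (uf F q * ((kU F q ^ t : (Uq F q)ˣ) : Uq F q)) ∧
      φ.symm (ue F q) = (q ^ (-1 - t) * (q - q⁻¹)⁻¹ * θ) •
        (((yU F q ^ t : (Ueq F q)ˣ) : Ueq F q) * (1 - uy F q * ux F q)) ∧
      φ.symm (uf F q) = (q ^ t * (q - q⁻¹)⁻¹ * θ⁻¹) •
        ((uz F q - uyi F q) * ((yU F q ^ (-t) : (Ueq F q)ˣ) : Ueq F q)) ∧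
      φ.symm (uk F q) = uy F q ∧
      φ.symm (uki F q) = uyi F q := by
  have hd : q - q⁻¹ ≠ 0 := by
    intro h
    apply hroot 2 (by norm_num)
    field_simp at h
    linear_combination h
  have hd' : q ^ 2 - 1 ≠ 0 := sub_ne_zero.mpr (hroot 2 (by norm_num))
  have hr : q ^ t ≠ 0 := zpow_ne_zero _ hq
  have p1 : q ^ (1 + t) = q * q ^ t := zpow_one_add₀ hq t
  have p2 : q ^ (-t) = (q ^ t)⁻¹ := zpow_neg q t
  have p3 : q ^ (-1 - t) = q⁻¹ * (q ^ t)⁻¹ := by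
    rw [zpow_sub₀ hq, zpow_neg_one, div_eq_mul_inv]
  have p4 : (q ^ 2) ^ t = (q ^ t) ^ 2 := by
    rw [← zpow_natCast, ← zpow_natCast, zpow_comm]
  have p5 : (q⁻¹ ^ 2) ^ t = ((q ^ t)⁻¹) ^ 2 := by
    rw [← inv_zpow, ← zpow_natCast, ← zpow_natCast, zpow_comm]
  have k1 : kU F q ^ (-1 - t) = (kU F q)⁻¹ * (kU F q ^ t)⁻¹ := by
    rw [zpow_sub, zpow_neg_one]
  have y1 : yU F q ^ (-t) = (yU F q ^ t)⁻¹ := zpow_neg _ _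
  have vk : ((kU F q : (Uq F q)ˣ) : Uq F q) = uk F q := rfl
  have vki : (((kU F q)⁻¹ : (Uq F q)ˣ) : Uq F q) = uki F q := rfl
  have vy : ((yU F q : (Ueq F q)ˣ) : Ueq F q) = uy F q := rfl
  have vyi : (((yU F q)⁻¹ : (Ueq F q)ˣ) : Ueq F q) = uyi F q := rfl
  have hke : uk F q * ue F q = (q ^ 2) • (ue F q * uk F q) := by
    simpa [uk, ue] using RingQuot.mkAlgHom_rel F (ChevRel.ke (F := F) (q := q))
  have hkf : uk F q * uf F q = (q⁻¹ ^ 2) • (uf F q * uk F q) := by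
    simpa [uk, uf] using RingQuot.mkAlgHom_rel F (ChevRel.kf (F := F) (q := q))
  have hef : ue F q * uf F q - uf F q * ue F q = ((q - q⁻¹)⁻¹) • (uk F q - uki F q) := by
    simpa only [uk, uf, ue, uki, map_mul, map_sub, map_smul] using
      RingQuot.mkAlgHom_rel F (ChevRel.ef (F := F) (q := q))
  have hxy : ((q - q⁻¹)⁻¹) • (q • (ux F q * uy F q) - q⁻¹ • (uy F q * ux F q)) = 1 := by
    simpa only [ux, uy, map_mul, map_sub, map_smul, map_one] using
      RingQuot.mkAlgHom_rel F (EqRel.xy (F := F) (q := q))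
  have hyz : ((q - q⁻¹)⁻¹) • (q • (uy F q * uz F q) - q⁻¹ • (uz F q * uy F q)) = 1 := by
    simpa only [uz, uy, map_mul, map_sub, map_smul, map_one] using
      RingQuot.mkAlgHom_rel F (EqRel.yz (F := F) (q := q))
  have hzx : ((q - q⁻¹)⁻¹) • (q • (uz F q * ux F q) - q⁻¹ • (ux F q * uz F q)) = 1 := by
    simpa only [ux, uz, map_mul, map_sub, map_smul, map_one] using
      RingQuot.mkAlgHom_rel F (EqRel.zx (F := F) (q := q))
  rw [p1, p2, p3, k1, y1]
  obtain ⟨X, hX⟩ : ∃ X : Uq F q, X = uki F q - (q * q ^ t * (q - q⁻¹) * θ⁻¹) •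
    ((((kU F q)⁻¹ * (kU F q ^ t)⁻¹ : (Uq F q)ˣ) : Uq F q) * ue F q) := ⟨_, rfl⟩
  obtain ⟨Z, hZ⟩ : ∃ Z : Uq F q, Z = uki F q +
    ((q ^ t)⁻¹ * (q - q⁻¹) * θ) • (uf F q * ((kU F q ^ t : (Uq F q)ˣ) : Uq F q)) := ⟨_, rfl⟩
  obtain ⟨E, hE⟩ : ∃ E : Ueq F q, E = (q⁻¹ * (q ^ t)⁻¹ * (q - q⁻¹)⁻¹ * θ) •
    (((yU F q ^ t : (Ueq F q)ˣ) : Ueq F q) * (1 - uy F q * ux F q)) := ⟨_, rfl⟩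
  obtain ⟨G, hG⟩ : ∃ G : Ueq F q, G = (q ^ t * (q - q⁻¹)⁻¹ * θ⁻¹) •
    ((uz F q - uyi F q) * (((yU F q ^ t)⁻¹ : (Ueq F q)ˣ) : Ueq F q)) := ⟨_, rfl⟩
  rw [← hX, ← hZ, ← hE, ← hG]
  obtain ⟨f1, f2, f3⟩ := fwd (kU F q) (kU F q ^ t) (ue F q) (uf F q) (q ^ t) θ hq hd hr hθ
    (Commute.zpow_left (Commute.refl _) t).eq hke hkf
    (p4 ▸ zpow_comm_smul (kU F q) (ue F q) (q ^ 2) (pow_ne_zero _ hq) hke t)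
    (p5 ▸ zpow_comm_smul (kU F q) (uf F q) (q⁻¹ ^ 2) (pow_ne_zero _ (inv_ne_zero hq)) hkf t)
    hef X Z hX hZ
  obtain ⟨b1, b2, b3⟩ := bwd (yU F q) (yU F q ^ t) (ux F q) (uz F q) (q ^ t) θ hq hd hr hθ
    (Commute.zpow_left (Commute.refl _) t).eq
    (fun h => p4 ▸ zpow_comm_smul (yU F q) _ (q ^ 2) (pow_ne_zero _ hq) h t)
    (fun h => p5 ▸ zpow_comm_smul (yU F q) _ (q⁻¹ ^ 2) (pow_ne_zero _ (inv_ne_zero hq)) h t)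
    hxy hyz hzx E G hE hG
  rw [vk] at f1 f2
  rw [vy] at b1 b2 b3
  rw [vyi] at b3
  let φ : Ueq F q →ₐ[F] Uq F q := RingQuot.liftAlgHom F
    ⟨FreeAlgebra.lift F ![X, uk F q, uki F q, Z], by
      intro a b h
      cases h with
      | yyi => simp only [map_mul, map_one, FreeAlgebra.lift_ι_apply]; exact (kU F q).mul_inv
      | yiy => simp only [map_mul, map_one, FreeAlgebra.lift_ι_apply]; exact (kU F q).inv_mul
      | xy => simp only [map_mul, map_sub, map_smul, map_one, FreeAlgebra.lift_ι_apply]; exact f1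
      | yz => simp only [map_mul, map_sub, map_smul, map_one, FreeAlgebra.lift_ι_apply]; exact f2
      | zx => simp only [map_mul, map_sub, map_smul, map_one, FreeAlgebra.lift_ι_apply]; exact f3⟩
  let ψ : Uq F q →ₐ[F] Ueq F q := RingQuot.liftAlgHom F
    ⟨FreeAlgebra.lift F ![E, G, uy F q, uyi F q], by
      intro a b h
      cases h with
      | kki => simp only [map_mul, map_one, FreeAlgebra.lift_ι_apply]; exact (yU F q).mul_inv
      | kik => simp only [map_mul, map_one, FreeAlgebra.lift_ι_apply]; exact (yU F q).inv_mul
      | ke => simp only [map_mul, map_sub, map_smul, map_one, FreeAlgebra.lift_ι_apply]; exact b1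
      | kf => simp only [map_mul, map_sub, map_smul, map_one, FreeAlgebra.lift_ι_apply]; exact b2
      | ef => simp only [map_mul, map_sub, map_smul, map_one, FreeAlgebra.lift_ι_apply]; exact b3⟩
  have φx : φ (ux F q) = X := by simp [φ, ux]
  have φy : φ (uy F q) = uk F q := by simp [φ, uy]
  have φyi : φ (uyi F q) = uki F q := by simp [φ, uyi]
  have φz : φ (uz F q) = Z := by simp [φ, uz]
  have ψe : ψ (ue F q) = E := by simp [ψ, ue]
  have ψf : ψ (uf F q) = G := by simp [ψ, uf]
  have ψk : ψ (uk F q) = uy F q := by simp [ψ, uk]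
  have ψki : ψ (uki F q) = uyi F q := by simp [ψ, uki]
  have my : Units.map (φ : Ueq F q →* Uq F q) (yU F q) = kU F q := Units.ext φy
  have mk : Units.map (ψ : Uq F q →* Ueq F q) (kU F q) = yU F q := Units.ext ψk
  have φu (n : ℤ) : φ ((yU F q ^ n : (Ueq F q)ˣ) : Ueq F q) = ((kU F q ^ n : (Uq F q)ˣ) : Uq F q) := by
    rw [← my, ← map_zpow]; rfl
  have ψu (n : ℤ) : ψ ((kU F q ^ n : (Uq F q)ˣ) : Uq F q) = ((yU F q ^ n : (Ueq F q)ˣ) : Ueq F q) := by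
    rw [← mk, ← map_zpow]; rfl
  have φu' : φ (((yU F q ^ t)⁻¹ : (Ueq F q)ˣ) : Ueq F q) = (((kU F q ^ t)⁻¹ : (Uq F q)ˣ) : Uq F q) := by
    rw [← zpow_neg, ← zpow_neg, φu]
  have ψu' : ψ (((kU F q ^ t)⁻¹ : (Uq F q)ˣ) : Uq F q) = (((yU F q ^ t)⁻¹ : (Ueq F q)ˣ) : Ueq F q) := by
    rw [← zpow_neg, ← zpow_neg, ψu]
  have φE : φ E = ue F q := by
    have : 1 - uk F q * X = (q * q ^ t * (q - q⁻¹) * θ⁻¹) •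
        ((((kU F q ^ t)⁻¹ : (Uq F q)ˣ) : Uq F q) * ue F q) := by
      rw [hX, ← vk, ← vki, Units.val_mul, mul_sub, mul_smul_comm, Units.mul_inv,
        mul_assoc (((kU F q)⁻¹ : (Uq F q)ˣ) : Uq F q), Units.mul_inv_cancel_left, sub_sub_cancel]
    rw [hE, map_smul, map_mul, map_sub, map_one, map_mul, φu, φy, φx, this, mul_smul_comm,
      Units.mul_inv_cancel_left, smul_smul]
    convert one_smul F (ue F q)
    field_simp
  have φG : φ G = uf F q := by
    rw [hG, map_smul, map_mul, map_sub, φu', φz, φyi, hZ, add_sub_cancel_left, smul_mul_assoc,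
      Units.mul_inv_cancel_right, smul_smul]
    convert one_smul F (uf F q)
    field_simp
  have ψX : ψ X = ux F q := by
    rw [hX, map_sub, map_smul, map_mul, Units.val_mul, map_mul, ψu', vki, ψki, ψe, hE,
      mul_smul_comm, smul_smul, mul_assoc (uyi F q), Units.inv_mul_cancel_left, mul_sub (uyi F q), ← vyi, ← vy,
      Units.inv_mul_cancel_left, mul_one]
    have : q * q ^ t * (q - q⁻¹) * θ⁻¹ * (q⁻¹ * (q ^ t)⁻¹ * (q - q⁻¹)⁻¹ * θ) = 1 := by field_simp
    rw [this, one_smul, sub_sub_cancel]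
  have ψZ : ψ Z = uz F q := by
    rw [hZ, map_add, map_smul, map_mul, ψu, ψki, ψf, hG,
      smul_mul_assoc, smul_smul, Units.inv_mul_cancel_right]
    have : (q ^ t)⁻¹ * (q - q⁻¹) * θ * (q ^ t * (q - q⁻¹)⁻¹ * θ⁻¹) = 1 := by field_simp
    rw [this, one_smul, add_sub_cancel]
  refine ⟨AlgEquiv.ofAlgHom φ ψ ?_ ?_, φx, φy, φyi, φz, ψe, ψf, ψk, ψki⟩
  · apply RingQuot.ringQuot_ext'
    apply FreeAlgebra.hom_ext
    funext i
    fin_cases i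
    · change φ (ψ (ue F q)) = ue F q
      rw [ψe, φE]
    · change φ (ψ (uf F q)) = uf F q
      rw [ψf, φG]
    · change φ (ψ (uk F q)) = uk F q
      rw [ψk, φy]
    · change φ (ψ (uki F q)) = uki F q
      rw [ψki, φyi]
  · apply RingQuot.ringQuot_ext'
    apply FreeAlgebra.hom_ext
    funext i
    fin_cases i
    · change ψ (φ (ux F q)) = ux F q
      rw [φx, ψX]
    · change ψ (φ (uy F q)) = uy F q
      rw [φy, ψk]
    · change ψ (φ (uyi F q)) = uyi F q
      rw [φyi, ψki]
    · change ψ (φ (uz F q)) = uz F q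
      rw [φz, ψZ]

end Lusztig
end

section
/- For every nonzero θ ∈ F and every t ∈ ℤ, there is an F-algebra isomorphism from U_eq to U_q(sl2) sending x ↦ k − k^{1+t} f q^{1+t}(q − q⁻¹)θ⁻¹, y^{±1} ↦ k^{∓1}, z ↦ k + e k^{−t} q^{−t}(q − q⁻¹)θ; its inverse sends e ↦ (z − y⁻¹) y^{−t} q^{t}(q − q⁻¹)⁻¹ θ⁻¹, f ↦ y^{t}(1 − yx) q^{−1−t}(q − q⁻¹)⁻¹ θ, k^{±1} ↦ y^{∓1}. -/
namespace Lusztig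

variable (F : Type*) [Field F] (q : F)



section helpers
variable {K A : Type*} [Field K] [Ring A] [Algebra K A]

/-- twisted commutation for two twisted elements with opposite weights -/
theorem aux_comm (u : Aˣ) (a b : A) (c : K) (hc : c ≠ 0)
    (h1 : (u : A) * a = c • (a * (u : A))) (h2 : (u : A) * b = c⁻¹ • (b * (u : A))) (t : ℤ) :
    ((u ^ t : Aˣ) : A) * (a * b) = (a * b) * ((u ^ t : Aˣ) : A) := by
  have h : Commute (a * b) (u : A) := by
    show a * b * (u : A) = u * (a * b)
    rw [← mul_assoc, h1, smul_mul_assoc, mul_assoc a (u : A) b, h2, mul_smul_comm, smul_smul,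
      mul_inv_cancel₀ hc, one_smul, mul_assoc]
  exact (h.units_zpow_right t).symm.eq

theorem aux_inv (u : Aˣ) (a : A) (c : K) (hc : c ≠ 0)
    (h1 : (u : A) * a = c • (a * (u : A))) :
    ((u⁻¹ : Aˣ) : A) * a = c⁻¹ • (a * ((u⁻¹ : Aˣ) : A)) := by
  rw [Units.inv_mul_eq_iff_eq_mul, mul_smul_comm, ← mul_assoc, h1, smul_mul_assoc, smul_smul,
    inv_mul_cancel₀ hc, one_smul, Units.mul_inv_cancel_right]

theorem aux_xy (q : K) (hq : q ≠ 0) (hd : q - q⁻¹ ≠ 0) (u : Aˣ) (f : A) (c : K) (t : ℤ)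
    (hf : (u : A) * f = (q⁻¹ ^ 2) • (f * (u : A))) :
    ((q - q⁻¹)⁻¹) • (q • (((u : A) - c • (((u ^ (1 + t) : Aˣ) : A) * f)) * ((u⁻¹ : Aˣ) : A))
      - q⁻¹ • (((u⁻¹ : Aˣ) : A) * ((u : A) - c • (((u ^ (1 + t) : Aˣ) : A) * f)))) = 1 := by
  have h1 := aux_inv u f (q⁻¹ ^ 2) (by positivity) hf
  have h2 : f * ((u⁻¹ : Aˣ) : A) = (q⁻¹ ^ 2) • (((u⁻¹ : Aˣ) : A) * f) := by
    rw [h1, smul_smul, mul_inv_cancel₀ (by positivity), one_smul]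
  have h3 : ((u ^ (1 + t) : Aˣ) : A) * ((u⁻¹ : Aˣ) : A) = ((u ^ t : Aˣ) : A) := by
    rw [← Units.val_mul, ← zpow_sub_one]; congr 2; ring
  have h4 : ((u⁻¹ : Aˣ) : A) * ((u ^ (1 + t) : Aˣ) : A) = ((u ^ t : Aˣ) : A) := by
    rw [← Units.val_mul, zpow_add, zpow_one, inv_mul_cancel_left]
  have e1 : ((u ^ (1 + t) : Aˣ) : A) * f * ((u⁻¹ : Aˣ) : A) =
      (q⁻¹ ^ 2) • (((u ^ t : Aˣ) : A) * f) := by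
    rw [mul_assoc, h2, mul_smul_comm, ← mul_assoc, h3]
  have e2 : ((u⁻¹ : Aˣ) : A) * (((u ^ (1 + t) : Aˣ) : A) * f) = ((u ^ t : Aˣ) : A) * f := by
    rw [← mul_assoc, h4]
  rw [inv_smul_eq_iff₀ hd, sub_mul, mul_sub, smul_mul_assoc, mul_smul_comm, e1, e2, Units.mul_inv, Units.inv_mul]
  match_scalars <;> field_simp <;> ring

theorem aux_yz (q : K) (hq : q ≠ 0) (hd : q - q⁻¹ ≠ 0) (u : Aˣ) (e : A) (c : K) (t : ℤ)
    (he : (u : A) * e = (q ^ 2) • (e * (u : A))) :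
    ((q - q⁻¹)⁻¹) • (q • (((u⁻¹ : Aˣ) : A) * ((u : A) + c • (e * ((u ^ (-t) : Aˣ) : A))))
      - q⁻¹ • (((u : A) + c • (e * ((u ^ (-t) : Aˣ) : A))) * ((u⁻¹ : Aˣ) : A))) = 1 := by
  have h1 := aux_inv u e (q ^ 2) (by positivity) he
  have h5 : ((u⁻¹ : Aˣ) : A) * ((u ^ (-t) : Aˣ) : A) =
      ((u ^ (-t) : Aˣ) : A) * ((u⁻¹ : Aˣ) : A) := by
    rw [← Units.val_mul, ← Units.val_mul, ← zpow_neg_one, ← zpow_add, ← zpow_add, add_comm]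
  have e1 : ((u⁻¹ : Aˣ) : A) * (e * ((u ^ (-t) : Aˣ) : A)) =
      ((q ^ 2)⁻¹) • (e * ((u ^ (-t) : Aˣ) : A) * ((u⁻¹ : Aˣ) : A)) := by
    rw [← mul_assoc, h1, smul_mul_assoc, mul_assoc, h5, mul_assoc]
  rw [inv_smul_eq_iff₀ hd, add_mul, mul_add, smul_mul_assoc, mul_smul_comm, e1, Units.mul_inv, Units.inv_mul]
  match_scalars <;> field_simp <;> ring

theorem aux_zx (q : K) (hq : q ≠ 0) (hd : q - q⁻¹ ≠ 0) (u : Aˣ) (e f : A) (c d : K) (t : ℤ)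
    (hcd : c * d = q * (q - q⁻¹) ^ 2)
    (he : (u : A) * e = (q ^ 2) • (e * (u : A)))
    (hf : (u : A) * f = (q⁻¹ ^ 2) • (f * (u : A)))
    (hef : e * f - f * e = ((q - q⁻¹)⁻¹) • ((u : A) - ((u⁻¹ : Aˣ) : A))) :
    ((q - q⁻¹)⁻¹) • (q • (((u : A) + d • (e * ((u ^ (-t) : Aˣ) : A))) *
        ((u : A) - c • (((u ^ (1 + t) : Aˣ) : A) * f)))
      - q⁻¹ • (((u : A) - c • (((u ^ (1 + t) : Aˣ) : A) * f)) *
        ((u : A) + d • (e * ((u ^ (-t) : Aˣ) : A))))) = 1 := by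
  have hq2 : q ^ 2 ≠ 0 := by positivity
  have hfe := aux_comm u f e (q⁻¹ ^ 2) (by positivity) hf (by simpa using he) (1 + t)
  have c1 : ((u ^ (-t) : Aˣ) : A) * (u : A) = (u : A) * ((u ^ (-t) : Aˣ) : A) :=
    by rw [← Units.val_mul, ← Units.val_mul, ← zpow_add_one, ← zpow_one_add, add_comm]
  have c2 : ((u ^ (1 + t) : Aˣ) : A) * (u : A) = (u : A) * ((u ^ (1 + t) : Aˣ) : A) :=
    by rw [← Units.val_mul, ← Units.val_mul, ← zpow_add_one, ← zpow_one_add, add_comm]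
  have c3 : ((u ^ (-t) : Aˣ) : A) * ((u ^ (1 + t) : Aˣ) : A) = (u : A) := by
    rw [← Units.val_mul, ← zpow_add]; simp
  have c4 : ((u ^ (1 + t) : Aˣ) : A) * ((u ^ (-t) : Aˣ) : A) = (u : A) := by
    rw [← Units.val_mul, ← zpow_add]; simp
  have hf2 : f * (u : A) = (q ^ 2) • ((u : A) * f) := by
    rw [hf, smul_smul]; field_simp; simp
  -- the cross terms
  have e1 : (u : A) * (e * ((u ^ (-t) : Aˣ) : A)) =
      (q ^ 2) • (e * ((u ^ (-t) : Aˣ) : A) * (u : A)) := by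
    rw [← mul_assoc, he, smul_mul_assoc, mul_assoc, mul_assoc, c1]
  have e2 : ((u ^ (1 + t) : Aˣ) : A) * f * (u : A) =
      (q ^ 2) • ((u : A) * (((u ^ (1 + t) : Aˣ) : A) * f)) := by
    rw [mul_assoc, hf2, mul_smul_comm, ← mul_assoc, c2, mul_assoc]
  have e3 : e * ((u ^ (-t) : Aˣ) : A) * (((u ^ (1 + t) : Aˣ) : A) * f) =
      (q⁻¹ ^ 2) • (e * f * (u : A)) := by
    rw [mul_assoc, ← mul_assoc _ _ f, c3, hf, mul_smul_comm, mul_assoc]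
  have e4 : ((u ^ (1 + t) : Aˣ) : A) * f * (e * ((u ^ (-t) : Aˣ) : A)) = f * e * (u : A) := by
    rw [mul_assoc, ← mul_assoc f e, ← mul_assoc, hfe, mul_assoc, c4]
  have e5 : e * f * (u : A) = f * e * (u : A) + ((q - q⁻¹)⁻¹) • ((u : A) * (u : A) - 1) := by
    have := congrArg (· * (u : A)) hef
    simp only [sub_mul, smul_mul_assoc, Units.inv_mul] at this
    rw [← this]; abel
  rw [add_mul, sub_mul, mul_add, mul_sub, mul_sub, mul_add]
  simp only [smul_mul_assoc, mul_smul_comm]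
  rw [e1, e2, e3, e4, e5]
  have hd0 : d ≠ 0 := by
    rintro rfl
    rw [mul_zero] at hcd
    exact mul_ne_zero hq (pow_ne_zero 2 hd) hcd.symm
  have hc : c = q * (q - q⁻¹) ^ 2 / d := by rw [eq_div_iff hd0, hcd]
  have hd' : q ^ 2 - 1 ≠ 0 := by
    intro h; apply hd
    have : q - q⁻¹ = q⁻¹ * (q ^ 2 - 1) := by field_simp
    rw [this, h, mul_zero]
  subst hc
  rw [inv_smul_eq_iff₀ hd]
  match_scalars <;> field_simp <;> ring

theorem aux_n (q : K) (hq : q ≠ 0) (hd : q - q⁻¹ ≠ 0) (u : Aˣ) (z : A)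
    (h : ((q - q⁻¹)⁻¹) • (q • ((u : A) * z) - q⁻¹ • (z * (u : A))) = 1) :
    (u : A) * (z - ((u⁻¹ : Aˣ) : A)) = (q⁻¹ ^ 2) • ((z - ((u⁻¹ : Aˣ) : A)) * (u : A)) := by
  rw [inv_smul_eq_iff₀ hd] at h
  rw [mul_sub, sub_mul, Units.mul_inv, Units.inv_mul]
  have := congrArg (q⁻¹ • ·) h
  simp only [smul_sub, smul_smul] at this
  rw [inv_mul_cancel₀ hq, one_smul] at this
  rw [sub_eq_iff_eq_add] at this ⊢
  rw [this]
  match_scalars <;> field_simp <;> ring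

theorem aux_m (q : K) (hq : q ≠ 0) (hd : q - q⁻¹ ≠ 0) (u : Aˣ) (x : A)
    (h : ((q - q⁻¹)⁻¹) • (q • (x * (u : A)) - q⁻¹ • ((u : A) * x)) = 1) :
    (u : A) * (1 - (u : A) * x) = (q ^ 2) • ((1 - (u : A) * x) * (u : A)) := by
  rw [inv_smul_eq_iff₀ hd] at h
  have := congrArg (q • ·) (congrArg ((u : A) * ·) h)
  simp only [mul_sub, smul_sub, smul_smul, mul_smul_comm, mul_inv_cancel₀ hq, one_smul,
    mul_one] at this
  rw [mul_sub, sub_mul, smul_sub, mul_assoc, mul_one, one_mul]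
  rw [sub_eq_iff_eq_add] at this
  have h2 : (q ^ 2) • ((u : A) * (x * (u : A))) = (q * q) • ((u : A) * (x * (u : A))) := by
    rw [sq]
  rw [h2, this]
  match_scalars <;> field_simp <;> ring

theorem aux_nm (q : K) (hq : q ≠ 0) (hd : q - q⁻¹ ≠ 0) (u : Aˣ) (x z : A)
    (hxy : ((q - q⁻¹)⁻¹) • (q • (x * (u : A)) - q⁻¹ • ((u : A) * x)) = 1)
    (hyz : ((q - q⁻¹)⁻¹) • (q • ((u : A) * z) - q⁻¹ • (z * (u : A))) = 1)
    (hzx : ((q - q⁻¹)⁻¹) • (q • (z * x) - q⁻¹ • (x * z)) = 1) :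
    (z - ((u⁻¹ : Aˣ) : A)) * (1 - (u : A) * x) - (1 - (u : A) * x) * (z - ((u⁻¹ : Aˣ) : A)) =
      (q * (q - q⁻¹)) • (((u⁻¹ : Aˣ) : A) - (u : A)) := by
  rw [inv_smul_eq_iff₀ hd] at hxy hyz hzx
  have a1 := congrArg (· * ((u⁻¹ : Aˣ) : A)) hxy
  have a2 := congrArg (· * x) hyz
  have a3 := congrArg ((u : A) * ·) hzx
  simp only [sub_mul, mul_sub, smul_mul_assoc, mul_smul_comm, one_mul, mul_one, mul_assoc,
    Units.mul_inv, Units.inv_mul_cancel_left] at a1 a2 a3 ⊢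
  linear_combination (norm := skip) q • a1 + q • a2 - q • a3
  match_scalars <;> field_simp <;> ring

theorem aux_EF (q : K) (hq : q ≠ 0) (hd : q - q⁻¹ ≠ 0) (u : Aˣ) (x z : A) (a b : K) (t : ℤ)
    (hab : a * b * (q * (q - q⁻¹)) = (q - q⁻¹)⁻¹)
    (hxy : ((q - q⁻¹)⁻¹) • (q • (x * (u : A)) - q⁻¹ • ((u : A) * x)) = 1)
    (hyz : ((q - q⁻¹)⁻¹) • (q • ((u : A) * z) - q⁻¹ • (z * (u : A))) = 1)
    (hzx : ((q - q⁻¹)⁻¹) • (q • (z * x) - q⁻¹ • (x * z)) = 1) :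
    (a • ((z - ((u⁻¹ : Aˣ) : A)) * ((u ^ (-t) : Aˣ) : A))) *
        (b • (((u ^ t : Aˣ) : A) * (1 - (u : A) * x))) -
      (b • (((u ^ t : Aˣ) : A) * (1 - (u : A) * x))) *
        (a • ((z - ((u⁻¹ : Aˣ) : A)) * ((u ^ (-t) : Aˣ) : A))) =
      ((q - q⁻¹)⁻¹) • (((u⁻¹ : Aˣ) : A) - (u : A)) := by
  have hn := aux_n q hq hd u z hyz
  have hm := aux_m q hq hd u x hxy
  have hnm := aux_nm q hq hd u x z hxy hyz hzx
  generalize z - ((u⁻¹ : Aˣ) : A) = n at *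
  generalize 1 - (u : A) * x = m at *
  have hc := aux_comm u m n (q ^ 2) (by positivity) hm (by simpa using hn) t
  have c1 : ((u ^ (-t) : Aˣ) : A) * ((u ^ t : Aˣ) : A) = 1 := by
    rw [← Units.val_mul, ← zpow_add]; simp
  have c2 : ((u ^ t : Aˣ) : A) * ((u ^ (-t) : Aˣ) : A) = 1 := by
    rw [← Units.val_mul, ← zpow_add]; simp
  have e1 : n * ((u ^ (-t) : Aˣ) : A) * (((u ^ t : Aˣ) : A) * m) = n * m := by
    rw [mul_assoc, ← mul_assoc _ _ m, c1, one_mul]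
  have e2 : ((u ^ t : Aˣ) : A) * m * (n * ((u ^ (-t) : Aˣ) : A)) = m * n := by
    rw [mul_assoc, ← mul_assoc m n, ← mul_assoc, hc, mul_assoc, c2, mul_one]
  simp only [smul_mul_assoc, mul_smul_comm, smul_smul]
  rw [e1, e2, mul_comm b a, ← smul_sub, hnm, smul_smul, hab]

theorem aux_E (q : K) (hq : q ≠ 0) (u : Aˣ) (n : A) (a : K) (t : ℤ)
    (hn : (u : A) * n = (q⁻¹ ^ 2) • (n * (u : A))) :
    ((u⁻¹ : Aˣ) : A) * (a • (n * ((u ^ t : Aˣ) : A))) =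
      (q ^ 2) • ((a • (n * ((u ^ t : Aˣ) : A))) * ((u⁻¹ : Aˣ) : A)) := by
  have h := aux_inv u n (q⁻¹ ^ 2) (by positivity) hn
  have h5 : ((u⁻¹ : Aˣ) : A) * ((u ^ t : Aˣ) : A) =
      ((u ^ t : Aˣ) : A) * ((u⁻¹ : Aˣ) : A) := by
    rw [← Units.val_mul, ← Units.val_mul, ← zpow_neg_one, ← zpow_add, ← zpow_add, add_comm]
  rw [mul_smul_comm, ← mul_assoc, h, smul_mul_assoc, mul_assoc, h5, smul_mul_assoc, mul_assoc,
    smul_comm]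
  simp

theorem aux_F (q : K) (hq : q ≠ 0) (u : Aˣ) (m : A) (a : K) (t : ℤ)
    (hm : (u : A) * m = (q ^ 2) • (m * (u : A))) :
    ((u⁻¹ : Aˣ) : A) * (a • (((u ^ t : Aˣ) : A) * m)) =
      (q⁻¹ ^ 2) • ((a • (((u ^ t : Aˣ) : A) * m)) * ((u⁻¹ : Aˣ) : A)) := by
  have h := aux_inv u m (q ^ 2) (by positivity) hm
  have h5 : ((u⁻¹ : Aˣ) : A) * ((u ^ t : Aˣ) : A) =
      ((u ^ t : Aˣ) : A) * ((u⁻¹ : Aˣ) : A) := by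
    rw [← Units.val_mul, ← Units.val_mul, ← zpow_neg_one, ← zpow_add, ← zpow_add, add_comm]
  rw [mul_smul_comm, ← mul_assoc, h5, mul_assoc, h, smul_mul_assoc, mul_smul_comm, mul_assoc,
    smul_comm]
  simp

end helpers

/-- universal property of U_eq -/
theorem eq_lift {A : Type*} [Ring A] [Algebra F A] (x z : A) (u : Aˣ)
    (hxy : ((q - q⁻¹)⁻¹) • (q • (x * (u : A)) - q⁻¹ • ((u : A) * x)) = 1)
    (hyz : ((q - q⁻¹)⁻¹) • (q • ((u : A) * z) - q⁻¹ • (z * (u : A))) = 1)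
    (hzx : ((q - q⁻¹)⁻¹) • (q • (z * x) - q⁻¹ • (x * z)) = 1) :
    ∃ φ : Ueq F q →ₐ[F] A, φ (ux F q) = x ∧ φ (uy F q) = u ∧ φ (uyi F q) = ((u⁻¹ : Aˣ) : A) ∧
      φ (uz F q) = z := by
  refine ⟨RingQuot.liftAlgHom F ⟨FreeAlgebra.lift F ![x, u, ((u⁻¹ : Aˣ) : A), z], ?_⟩, ?_⟩
  · intro a b hab
    cases hab <;> simp <;> assumption
  · simp [ux, uy, uyi, uz]

/-- universal property of U_q -/
theorem chev_lift {A : Type*} [Ring A] [Algebra F A] (e f : A) (u : Aˣ)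
    (he : (u : A) * e = (q ^ 2) • (e * (u : A)))
    (hf : (u : A) * f = (q⁻¹ ^ 2) • (f * (u : A)))
    (hef : e * f - f * e = ((q - q⁻¹)⁻¹) • ((u : A) - ((u⁻¹ : Aˣ) : A))) :
    ∃ φ : Uq F q →ₐ[F] A, φ (ue F q) = e ∧ φ (uf F q) = f ∧ φ (uk F q) = u ∧
      φ (uki F q) = ((u⁻¹ : Aˣ) : A) := by
  refine ⟨RingQuot.liftAlgHom F ⟨FreeAlgebra.lift F ![e, f, u, ((u⁻¹ : Aˣ) : A)], ?_⟩, ?_⟩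
  · intro a b hab
    cases hab with
    | kki => simp
    | kik => simp
    | ke => simpa using he
    | kf => simpa using hf
    | ef => simpa using hef
  · simp [ue, uf, uk, uki]

theorem eq_ext {A : Type*} [Ring A] [Algebra F A] (φ ψ : Ueq F q →ₐ[F] A)
    (hx : φ (ux F q) = ψ (ux F q)) (hy : φ (uy F q) = ψ (uy F q))
    (hyi : φ (uyi F q) = ψ (uyi F q)) (hz : φ (uz F q) = ψ (uz F q)) : φ = ψ := by
  apply RingQuot.ringQuot_ext'
  apply FreeAlgebra.hom_ext
  funext i
  fin_cases i <;> assumption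

theorem chev_ext {A : Type*} [Ring A] [Algebra F A] (φ ψ : Uq F q →ₐ[F] A)
    (he : φ (ue F q) = ψ (ue F q)) (hf : φ (uf F q) = ψ (uf F q))
    (hk : φ (uk F q) = ψ (uk F q)) (hki : φ (uki F q) = ψ (uki F q)) : φ = ψ := by
  apply RingQuot.ringQuot_ext'
  apply FreeAlgebra.hom_ext
  funext i
  fin_cases i <;> assumption


/-- the secondary identification of type (θ, t): an F-algebra isomorphism
from the equitable presentation to the Chevalley presentation, with the indicated action
on generators, and whose inverse has the indicated action on generators. -/
theorem stmt1 (hq : q ≠ 0) (hroot : ∀ n : ℕ, 0 < n → q ^ n ≠ 1)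
    (θ : F) (hθ : θ ≠ 0) (t : ℤ) :
    ∃ φ : Ueq F q ≃ₐ[F] Uq F q,
      φ (ux F q) = uk F q -
        (q ^ (1 + t) * (q - q⁻¹) * θ⁻¹) • (((kU F q ^ (1 + t) : (Uq F q)ˣ) : Uq F q) * uf F q) ∧
      φ (uy F q) = uki F q ∧
      φ (uyi F q) = uk F q ∧
      φ (uz F q) = uk F q +
        (q ^ (-t) * (q - q⁻¹) * θ) • (ue F q * ((kU F q ^ (-t) : (Uq F q)ˣ) : Uq F q)) ∧
      φ.symm (ue F q) = (q ^ t * (q - q⁻¹)⁻¹ * θ⁻¹) •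
        ((uz F q - uyi F q) * ((yU F q ^ (-t) : (Ueq F q)ˣ) : Ueq F q)) ∧
      φ.symm (uf F q) = (q ^ (-1 - t) * (q - q⁻¹)⁻¹ * θ) •
        (((yU F q ^ t : (Ueq F q)ˣ) : Ueq F q) * (1 - uy F q * ux F q)) ∧
      φ.symm (uk F q) = uyi F q ∧
      φ.symm (uki F q) = uy F q := by
  have hd : q - q⁻¹ ≠ 0 := by
    intro h
    apply hroot 2 two_pos
    have h1 : q = q⁻¹ := sub_eq_zero.mp h
    rw [sq]
    nth_rewrite 2 [h1]
    exact mul_inv_cancel₀ hq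
  have he : ((kU F q : (Uq F q)ˣ) : Uq F q) * ue F q =
      (q ^ 2) • (ue F q * ((kU F q : (Uq F q)ˣ) : Uq F q)) := by
    have := RingQuot.mkAlgHom_rel F (ChevRel.ke (F := F) (q := q))
    rwa [map_mul, map_smul, map_mul] at this
  have hf : ((kU F q : (Uq F q)ˣ) : Uq F q) * uf F q =
      (q⁻¹ ^ 2) • (uf F q * ((kU F q : (Uq F q)ˣ) : Uq F q)) := by
    have := RingQuot.mkAlgHom_rel F (ChevRel.kf (F := F) (q := q))
    rwa [map_mul, map_smul, map_mul] at this
  have hef : ue F q * uf F q - uf F q * ue F q = ((q - q⁻¹)⁻¹) •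
      (((kU F q : (Uq F q)ˣ) : Uq F q) - (((kU F q)⁻¹ : (Uq F q)ˣ) : Uq F q)) := by
    have := RingQuot.mkAlgHom_rel F (ChevRel.ef (F := F) (q := q))
    rwa [map_sub, map_smul, map_mul, map_mul, map_sub] at this
  have hxy : ((q - q⁻¹)⁻¹) • (q • (ux F q * ((yU F q : (Ueq F q)ˣ) : Ueq F q)) -
      q⁻¹ • (((yU F q : (Ueq F q)ˣ) : Ueq F q) * ux F q)) = 1 := by
    have := RingQuot.mkAlgHom_rel F (EqRel.xy (F := F) (q := q))
    rwa [map_smul, map_sub, map_smul, map_smul, map_mul, map_mul, map_one] at this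
  have hyz : ((q - q⁻¹)⁻¹) • (q • (((yU F q : (Ueq F q)ˣ) : Ueq F q) * uz F q) -
      q⁻¹ • (uz F q * ((yU F q : (Ueq F q)ˣ) : Ueq F q))) = 1 := by
    have := RingQuot.mkAlgHom_rel F (EqRel.yz (F := F) (q := q))
    rwa [map_smul, map_sub, map_smul, map_smul, map_mul, map_mul, map_one] at this
  have hzx : ((q - q⁻¹)⁻¹) • (q • (uz F q * ux F q) - q⁻¹ • (ux F q * uz F q)) = 1 := by
    have := RingQuot.mkAlgHom_rel F (EqRel.zx (F := F) (q := q))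
    rwa [map_smul, map_sub, map_smul, map_smul, map_mul, map_mul, map_one] at this
  have hp : q ^ t ≠ 0 := zpow_ne_zero t hq
  have e1 : q ^ (1 + t) = q * q ^ t := by rw [zpow_add₀ hq, zpow_one]
  have e2 : q ^ (-t) = (q ^ t)⁻¹ := zpow_neg q t
  have e3 : q ^ (-1 - t) = q⁻¹ * (q ^ t)⁻¹ := by rw [sub_eq_add_neg, zpow_add₀ hq, e2, zpow_neg_one]
  obtain ⟨c, hc⟩ : ∃ c, c = q ^ (1 + t) * (q - q⁻¹) * θ⁻¹ := ⟨_, rfl⟩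
  obtain ⟨d, hdd⟩ : ∃ d, d = q ^ (-t) * (q - q⁻¹) * θ := ⟨_, rfl⟩
  obtain ⟨a, ha⟩ : ∃ a, a = q ^ t * (q - q⁻¹)⁻¹ * θ⁻¹ := ⟨_, rfl⟩
  obtain ⟨b, hb⟩ : ∃ b, b = q ^ (-1 - t) * (q - q⁻¹)⁻¹ * θ := ⟨_, rfl⟩
  rw [← hc, ← hdd, ← ha, ← hb]
  rw [e1] at hc
  rw [e2] at hdd
  rw [e3] at hb
  generalize q ^ t = p at *
  have hcd : c * d = q * (q - q⁻¹) ^ 2 := by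
    rw [hc, hdd]; generalize q - q⁻¹ = r at *; field_simp
  have hab : a * b * (q * (q - q⁻¹)) = (q - q⁻¹)⁻¹ := by
    rw [ha, hb]; generalize q - q⁻¹ = r at *; field_simp
  have hcb : c * b = 1 := by
    rw [hc, hb]; generalize q - q⁻¹ = r at *; field_simp
  have hda : d * a = 1 := by
    rw [hdd, ha]; generalize q - q⁻¹ = r at *; field_simp
  obtain ⟨φ, φx, φy, φyi, φz⟩ := eq_lift F q
    (((kU F q : (Uq F q)ˣ) : Uq F q) - c • (((kU F q ^ (1 + t) : (Uq F q)ˣ) : Uq F q) * uf F q))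
    (((kU F q : (Uq F q)ˣ) : Uq F q) + d • (ue F q * ((kU F q ^ (-t) : (Uq F q)ˣ) : Uq F q)))
    (kU F q)⁻¹
    (aux_xy q hq hd _ _ c t hf) (aux_yz q hq hd _ _ d t he)
    (aux_zx q hq hd _ _ _ c d t hcd he hf hef)
  obtain ⟨ψ, ψe, ψf, ψk, ψki⟩ := chev_lift F q
    (a • ((uz F q - (((yU F q)⁻¹ : (Ueq F q)ˣ) : Ueq F q)) *
      ((yU F q ^ (-t) : (Ueq F q)ˣ) : Ueq F q)))
    (b • (((yU F q ^ t : (Ueq F q)ˣ) : Ueq F q) *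
      (1 - ((yU F q : (Ueq F q)ˣ) : Ueq F q) * ux F q)))
    (yU F q)⁻¹
    (aux_E q hq _ _ a (-t) (aux_n q hq hd _ _ hyz))
    (aux_F q hq _ _ b t (aux_m q hq hd _ _ hxy))
    (by rw [inv_inv]; exact aux_EF q hq hd _ _ _ a b t hab hxy hyz hzx)
  rw [inv_inv] at φyi ψki
  have ψK : ∀ n : ℤ, ψ ((kU F q ^ n : (Uq F q)ˣ) : Uq F q) =
      ((yU F q ^ (-n) : (Ueq F q)ˣ) : Ueq F q) := by
    intro n
    have h : Units.map (ψ : Uq F q →* Ueq F q) (kU F q) = (yU F q)⁻¹ := Units.ext ψk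
    have h2 := congrArg (fun v : (Ueq F q)ˣ => ((v ^ n : (Ueq F q)ˣ) : Ueq F q)) h
    simp only [← map_zpow, inv_zpow, ← zpow_neg] at h2
    exact h2
  have φY : ∀ n : ℤ, φ ((yU F q ^ n : (Ueq F q)ˣ) : Ueq F q) =
      ((kU F q ^ (-n) : (Uq F q)ˣ) : Uq F q) := by
    intro n
    have h : Units.map (φ : Ueq F q →* Uq F q) (yU F q) = (kU F q)⁻¹ := Units.ext φy
    have h2 := congrArg (fun v : (Uq F q)ˣ => ((v ^ n : (Uq F q)ˣ) : Uq F q)) h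
    simp only [← map_zpow, inv_zpow, ← zpow_neg] at h2
    exact h2
  have φy' : φ ((yU F q : (Ueq F q)ˣ) : Ueq F q) = (((kU F q)⁻¹ : (Uq F q)ˣ) : Uq F q) := φy
  have φyi' : φ (((yU F q)⁻¹ : (Ueq F q)ˣ) : Ueq F q) = ((kU F q : (Uq F q)ˣ) : Uq F q) := φyi
  have ψk' : ψ ((kU F q : (Uq F q)ˣ) : Uq F q) = (((yU F q)⁻¹ : (Ueq F q)ˣ) : Ueq F q) := ψk
  have h1 : φ.comp ψ = AlgHom.id F (Uq F q) := by
    apply chev_ext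
    · rw [AlgHom.comp_apply, ψe, map_smul, map_mul, map_sub, φz, φyi', φY, add_sub_cancel_left,
        smul_mul_assoc, mul_assoc, ← Units.val_mul, ← zpow_add, smul_smul, mul_comm a d, hda]
      simp
    · rw [AlgHom.comp_apply, ψf, map_smul, map_mul, map_sub, map_one, map_mul, φx, φy', φY,
        mul_sub (((kU F q)⁻¹ : (Uq F q)ˣ) : Uq F q), Units.inv_mul, sub_sub_cancel, mul_smul_comm, mul_smul_comm, smul_smul,
        mul_comm b c, hcb, one_smul, ← mul_assoc, ← mul_assoc, ← Units.val_mul, ← Units.val_mul,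
        ← zpow_neg_one, ← zpow_add, ← zpow_add]
      simp
    · rw [AlgHom.comp_apply, ψk, φyi']; rfl
    · rw [AlgHom.comp_apply, ψki, φy']; rfl
  have h2 : ψ.comp φ = AlgHom.id F (Ueq F q) := by
    apply eq_ext
    · rw [AlgHom.comp_apply, φx, map_sub, map_smul, map_mul, ψk', ψK, ψf, mul_smul_comm, smul_smul,
        hcb, one_smul, ← mul_assoc, ← Units.val_mul, ← zpow_add]
      have : -(1 + t) + t = -1 := by ring
      rw [this, zpow_neg_one, mul_sub, Units.inv_mul_cancel_left]
      simp
    · rw [AlgHom.comp_apply, φy]; exact ψki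
    · rw [AlgHom.comp_apply, φyi, ψk']; rfl
    · rw [AlgHom.comp_apply, φz, map_add, map_smul, map_mul, ψk', ψK, ψe, smul_mul_assoc, smul_smul,
        hda, one_smul, mul_assoc, ← Units.val_mul, ← zpow_add]
      simp
  exact ⟨AlgEquiv.ofAlgHom φ ψ h1 h2, φx, φy, φyi, φz, ψe, ψf, ψk, ψki⟩

end Lusztig
end

section
/- Fix 0 ≠ θ ∈ F, t ∈ ℤ, and set Λ = (q − q⁻¹)² e f + q⁻¹ k + q k⁻¹ in U_q(sl2). If x = k⁻¹ − k^{−1−t} e q^{1+t}(q − q⁻¹)θ⁻¹, y = k, z = k⁻¹ + f k^{t} q^{−t}(q − q⁻¹)θ (primary identification), then Λ = q x + q⁻¹ y + q z − q x y z. If instead x = k − k^{1+t} f q^{1+t}(q − q⁻¹)θ⁻¹, y = k⁻¹, z = k + e k^{−t} q^{−t}(q − q⁻¹)θ (secondary identification), then Λ = q⁻¹ x + q y + q⁻¹ z − q⁻¹ z y x. -/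
namespace Lusztig

variable (F : Type*) [Field F] (q : F)



theorem aux1 {K A : Type*} [Field K] [Ring A] [Algebra K A] (q a b c : K) (e f k ki P T : A)
    (h1 : k * ki = 1) (h2 : ki * k = 1) (hP : P * (e * k * f) * T = (q⁻¹ ^ 2) • (e * f))
    (hab : q * (a * b) * (q⁻¹ ^ 2) = c ^ 2) :
    (c ^ 2) • (e * f) + q⁻¹ • k + q • ki =
      q • (ki - a • (P * e)) + q⁻¹ • k + q • (ki + b • (f * T))
        - q • ((ki - a • (P * e)) * k * (ki + b • (f * T))) := by
  have h : (ki - a • (P * e)) * k * (ki + b • (f * T)) =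
      ki + b • (f * T) - a • (P * e) - (a * b * q⁻¹ ^ 2) • (e * f) := by
    have e1 : P * e * k * ki = P * e := by rw [mul_assoc, h1, mul_one]
    have e2 : P * e * k * (f * T) = (q⁻¹ ^ 2) • (e * f) := by
      rw [← hP]; simp only [mul_assoc]
    simp only [sub_mul, mul_add, h2, one_mul, smul_mul_assoc, mul_smul_comm, e1, e2]
    module
  rw [h, ← hab]
  module

theorem aux2 {K A : Type*} [Field K] [Ring A] [Algebra K A] (q a b c : K) (e f k ki P T : A)
    (h1 : k * ki = 1) (h2 : ki * k = 1) (hP : T * ki * P = 1)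
    (hab : q⁻¹ * (a * b) = c ^ 2) :
    (c ^ 2) • (e * f) + q⁻¹ • k + q • ki =
      q⁻¹ • (k - a • (P * f)) + q • ki + q⁻¹ • (k + b • (e * T))
        - q⁻¹ • ((k + b • (e * T)) * ki * (k - a • (P * f))) := by
  have h : (k + b • (e * T)) * ki * (k - a • (P * f)) =
      k - a • (P * f) + b • (e * T) - (a * b) • (e * f) := by
    have e1 : e * T * ki * k = e * T := by rw [mul_assoc, h2, mul_one]
    have e2 : e * T * ki * (P * f) = e * f := by
      calc _ = e * (T * ki * P) * f := by simp only [mul_assoc]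
        _ = _ := by rw [hP, mul_one]
    simp only [add_mul, mul_sub, h1, one_mul, smul_mul_assoc, mul_smul_comm, e1, e2]
    module
  rw [h, ← hab]
  module

theorem aux3 {K A : Type*} [Field K] [Ring A] [Algebra K A] (q : K) (hq : q ≠ 0) (e f : A)
    (k : Aˣ) (t : ℤ) (he : (k : A) * e = (q ^ 2) • (e * (k : A)))
    (hf : (k : A) * f = (q⁻¹ ^ 2) • (f * (k : A))) :
    ((k ^ (-1 - t) : Aˣ) : A) * (e * (k : A) * f) * ((k ^ t : Aˣ) : A)
      = (q⁻¹ ^ 2) • (e * f) := by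
  have hc : Commute (e * f) (k : A) := by
    have : (k : A) * (e * f) = e * f * k := by
      rw [← mul_assoc, he, smul_mul_assoc, mul_assoc, hf, mul_smul_comm, smul_smul, ← mul_assoc,
        ← mul_pow, mul_inv_cancel₀ hq, one_pow, one_smul]
    exact this.symm
  have hc' : e * f * ((k ^ (-1 - t) : Aˣ) : A) = ((k ^ (-1 - t) : Aˣ) : A) * (e * f) :=
    (hc.units_zpow_right (-1 - t)).eq
  have hu : ((k ^ (-1 - t) : Aˣ) : A) * ((k : A) * ((k ^ t : Aˣ) : A)) = 1 := by
    rw [← Units.val_mul, ← Units.val_mul, ← zpow_one_add, ← zpow_add]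
    simp
  rw [mul_assoc e, hf, mul_smul_comm, mul_smul_comm, smul_mul_assoc, ← mul_assoc e, ← mul_assoc,
    ← hc', mul_assoc, mul_assoc, hu, mul_one]

/-- the normalized Casimir element Λ = (q − q⁻¹)² e f + q⁻¹ k + q k⁻¹,
expressed through the primary and the secondary identifications of type (θ, t). -/
theorem stmt4 (hq : q ≠ 0) (hroot : ∀ n : ℕ, 0 < n → q ^ n ≠ 1)
    (θ : F) (hθ : θ ≠ 0) (t : ℤ)
    (Λ : Uq F q)
    (hΛ : Λ = ((q - q⁻¹) ^ 2) • (ue F q * uf F q) + q⁻¹ • uk F q + q • uki F q) :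
    (∀ x y z : Uq F q,
      x = uki F q -
        (q ^ (1 + t) * (q - q⁻¹) * θ⁻¹) • (((kU F q ^ (-1 - t) : (Uq F q)ˣ) : Uq F q) * ue F q) →
      y = uk F q →
      z = uki F q +
        (q ^ (-t) * (q - q⁻¹) * θ) • (uf F q * ((kU F q ^ t : (Uq F q)ˣ) : Uq F q)) →
      Λ = q • x + q⁻¹ • y + q • z - q • (x * y * z)) ∧
    (∀ x y z : Uq F q,
      x = uk F q -
        (q ^ (1 + t) * (q - q⁻¹) * θ⁻¹) • (((kU F q ^ (1 + t) : (Uq F q)ˣ) : Uq F q) * uf F q) →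
      y = uki F q →
      z = uk F q +
        (q ^ (-t) * (q - q⁻¹) * θ) • (ue F q * ((kU F q ^ (-t) : (Uq F q)ˣ) : Uq F q)) →
      Λ = q⁻¹ • x + q • y + q⁻¹ • z - q⁻¹ • (z * y * x)) := by
  have hke : uk F q * ue F q = (q ^ 2) • (ue F q * uk F q) := by
    have h := RingQuot.mkAlgHom_rel F (ChevRel.ke (F := F) (q := q))
    simpa only [uk, ue, map_mul, map_smul] using h
  have hkf : uk F q * uf F q = (q⁻¹ ^ 2) • (uf F q * uk F q) := by
    have h := RingQuot.mkAlgHom_rel F (ChevRel.kf (F := F) (q := q))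
    simpa only [uk, uf, map_mul, map_smul] using h
  have h1 : uk F q * uki F q = 1 := (kU F q).val_inv
  have h2 : uki F q * uk F q = 1 := (kU F q).inv_val
  have hqt : q ^ (1 + t) * q ^ (-t) = q := by
    rw [← zpow_add₀ hq]; simp
  have hab : (q ^ (1 + t) * (q - q⁻¹) * θ⁻¹) * (q ^ (-t) * (q - q⁻¹) * θ)
      = q * (q - q⁻¹) ^ 2 := by
    calc _ = (q ^ (1 + t) * q ^ (-t)) * (q - q⁻¹) ^ 2 * (θ⁻¹ * θ) := by ring
      _ = _ := by rw [hqt, inv_mul_cancel₀ hθ, mul_one]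
  constructor
  · rintro x y z rfl rfl rfl
    rw [hΛ]
    refine aux1 q _ _ _ _ _ _ _ _ _ h1 h2 (aux3 q hq _ _ (kU F q) t hke hkf) ?_
    rw [hab]
    generalize q - q⁻¹ = c
    field_simp
  · rintro x y z rfl rfl rfl
    rw [hΛ]
    refine aux2 q _ _ _ _ _ _ _ _ _ h1 h2 ?_ ?_
    · have : kU F q ^ (-t) * (kU F q)⁻¹ * kU F q ^ (1 + t) = 1 := by
        rw [← zpow_sub_one, ← zpow_add, show -t - 1 + (1 + t) = 0 by ring, zpow_zero]
      exact congrArg Units.val this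
    · rw [hab]
      generalize q - q⁻¹ = c
      field_simp


end Lusztig
end

section
/- Fix 0 ≠ θ ∈ F and t ∈ ℤ, and let φ : U_eq → U_q(sl2) be the primary identification of type (θ,t). Then the automorphism L of U_q(sl2) satisfies L(φ(n_x)) = θ² q⁻¹ φ(y⁻¹ n_z y⁻¹), L(φ(y)) = φ(y⁻¹), L(φ(n_z)) = θ⁻² q φ(n_x), and its inverse satisfies L⁻¹(φ(n_x)) = θ² q⁻¹ φ(n_z), L⁻¹(φ(y)) = φ(y⁻¹), L⁻¹(φ(n_z)) = θ⁻² q φ(y⁻¹ n_x y⁻¹). -/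
namespace Lusztig

variable (F : Type*) [Field F] (q : F)



theorem zpow_comm_aux {F A : Type*} [Field F] [Ring A] [Algebra F A] (c : F) (hc : c ≠ 0)
    (K : Aˣ) (E : A) (h : (K : A) * E = c • (E * K)) (n : ℤ) :
    ((K ^ n : Aˣ) : A) * E = c ^ n • (E * ((K ^ n : Aˣ) : A)) := by
  have h' : ((K⁻¹ : Aˣ) : A) * E = c⁻¹ • (E * ((K⁻¹ : Aˣ) : A)) := by
    have h2 : E = c • (((K⁻¹ : Aˣ) : A) * (E * K)) := by
      rw [← mul_smul_comm, ← h, Units.inv_mul_cancel_left]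
    have h3 : E * ((K⁻¹ : Aˣ) : A) = c • (((K⁻¹ : Aˣ) : A) * E) := by
      conv_lhs => rw [h2]
      rw [smul_mul_assoc, mul_assoc, mul_assoc, Units.mul_inv, mul_one]
    rw [h3, smul_smul, inv_mul_cancel₀ hc, one_smul]
  induction n using Int.induction_on with
  | zero => simp
  | succ n ih =>
    rw [zpow_add_one, zpow_add_one₀ hc, Units.val_mul, mul_assoc, h, mul_smul_comm,
      ← mul_assoc, ih, smul_mul_assoc, smul_smul, mul_assoc, mul_comm c]
  | pred n ih =>
    rw [zpow_sub_one, zpow_sub_one₀ hc, Units.val_mul, mul_assoc, h', mul_smul_comm,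
      ← mul_assoc, ih, smul_mul_assoc, smul_smul, mul_assoc, mul_comm c⁻¹]

theorem main_aux {F A B : Type*} [Field F] [Ring A] [Algebra F A] [Ring B] [Algebra F B]
    (q : F) (hq : q ≠ 0) (hd : q - q⁻¹ ≠ 0) (θ : F) (hθ : θ ≠ 0) (t : ℤ)
    (φ : B ≃ₐ[F] A) (L : A ≃ₐ[F] A) (K : Aˣ) (e f : A) (x y yi z : B)
    (hφx : φ x = ((K⁻¹ : Aˣ) : A) -
      (q ^ (1 + t) * (q - q⁻¹) * θ⁻¹) • (((K ^ (-1 - t) : Aˣ) : A) * e))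
    (hφy : φ y = K) (hφyi : φ yi = ((K⁻¹ : Aˣ) : A))
    (hφz : φ z = ((K⁻¹ : Aˣ) : A) +
      (q ^ (-t) * (q - q⁻¹) * θ) • (f * ((K ^ t : Aˣ) : A)))
    (hLe : L e = -(f * K)) (hLf : L f = -(((K⁻¹ : Aˣ) : A) * e))
    (hLk : L K = ((K⁻¹ : Aˣ) : A)) (hLki : L ((K⁻¹ : Aˣ) : A) = K)
    (he : (K : A) * e = (q ^ 2) • (e * K))
    (hf : (K : A) * f = (q⁻¹ ^ 2) • (f * K))
    (nx nz : B)
    (hnx : nx = (q / (q - q⁻¹)) • (1 - y * z))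
    (hnz : nz = (q / (q - q⁻¹)) • (1 - x * y)) :
    L (φ nx) = (θ ^ 2 * q⁻¹) • φ (yi * nz * yi) ∧
    L (φ y) = φ yi ∧
    L (φ nz) = ((θ ^ 2)⁻¹ * q) • φ nx ∧
    L.symm (φ nx) = (θ ^ 2 * q⁻¹) • φ nz ∧
    L.symm (φ y) = φ yi ∧
    L.symm (φ nz) = ((θ ^ 2)⁻¹ * q) • φ (yi * nx * yi) := by
  have hE := zpow_comm_aux (q ^ 2) (pow_ne_zero 2 hq) K e he
  have hF := zpow_comm_aux (q⁻¹ ^ 2) (pow_ne_zero 2 (inv_ne_zero hq)) K (f) hf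
  have hLK : ∀ n : ℤ, L ((K ^ n : (A)ˣ) : A) = ((K ^ (-n) : (A)ˣ) : A) := by
    have h0 : Units.map (L : A →* A) K = K⁻¹ := by
      ext
      exact hLk
    intro n
    have h1 := congrArg (fun u : (A)ˣ => ((u ^ n : (A)ˣ) : A)) h0
    simp only [← map_zpow, inv_zpow'] at h1
    exact h1
  have hz : (q ^ 2) ^ t = (q ^ t) ^ 2 := by rw [pow_two, mul_zpow, pow_two]
  have n1 : φ nx = (-(q ^ (-1 - t) * θ)) • (f * ((K ^ (t + 1) : (A)ˣ) : A)) := by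
    rw [hnx, map_smul, map_sub, map_mul, map_one, hφy, hφz, mul_add, Units.mul_inv, mul_smul_comm,
      ← mul_assoc, hf, sub_add_cancel_left, smul_mul_assoc, mul_assoc f, ← Units.val_mul,
      ← zpow_one_add, smul_smul, add_comm 1 t, smul_neg, smul_smul, ← neg_smul]
    congr 1
    rw [zpow_sub₀ hq, zpow_neg, zpow_neg]
    have := zpow_ne_zero t hq
    simp only [zpow_one]
    clear hφx hφz hnx hnz
    generalize q - q⁻¹ = d at *
    field_simp
  have n2 : φ nz = (q ^ t * θ⁻¹) • (((K ^ (-t) : (A)ˣ) : A) * e) := by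
    have h1 : e * (K : A) = (q ^ 2)⁻¹ • ((K : A) * e) := by
      rw [he, smul_smul, inv_mul_cancel₀ (pow_ne_zero 2 hq), one_smul]
    rw [hnz, map_smul, map_sub, map_mul, map_one, hφy, hφx, sub_mul, Units.inv_mul, smul_mul_assoc,
      mul_assoc _ e, h1, sub_sub_cancel, mul_smul_comm, ← mul_assoc, ← Units.val_mul, ← zpow_add_one,
      smul_smul, smul_smul]
    rw [show -1 - t + 1 = -t by ring]
    congr 1
    rw [zpow_add₀ hq]
    have := zpow_ne_zero t hq
    simp only [zpow_one]
    clear hφx hφz hnx hnz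
    generalize q - q⁻¹ = d at *
    field_simp
  have A1 : L (φ nx) = (θ ^ 2 * q⁻¹) • φ (yi * nz * yi) := by
    rw [map_mul, map_mul, n1, n2, hφyi, map_smul, map_mul, hLf, hLK, mul_smul_comm, hE,
      smul_mul_assoc, smul_smul, mul_smul_comm, smul_mul_assoc, smul_smul, neg_mul, neg_smul,
      smul_neg, neg_neg, mul_assoc _ e, mul_assoc _ (e * _), mul_assoc e, ← Units.val_mul, ← zpow_sub_one]
    rw [show -(t + 1) = -t - 1 by ring]
    congr 1
    rw [zpow_sub₀ hq, zpow_neg, zpow_neg, hz]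
    have := zpow_ne_zero t hq
    simp only [zpow_one]
    field_simp
  have A3 : L (φ nz) = ((θ ^ 2)⁻¹ * q) • φ nx := by
    rw [n1, n2, map_smul, map_mul, hLe, hLK, neg_neg, mul_neg, ← mul_assoc _ f, hF, smul_mul_assoc,
      mul_assoc f, ← Units.val_mul, ← zpow_add_one, smul_neg, smul_smul, smul_smul, ← neg_smul]
    congr 1
    rw [zpow_sub₀ hq, zpow_neg, inv_pow, inv_zpow, hz]
    have := zpow_ne_zero t hq
    simp only [zpow_one]
    field_simp
  refine ⟨A1, ?_, A3, ?_, ?_, ?_⟩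
  · rw [hφy, hφyi, hLk]
  · rw [AlgEquiv.symm_apply_eq, map_smul, A3, smul_smul]
    rw [show θ ^ 2 * q⁻¹ * ((θ ^ 2)⁻¹ * q) = 1 by field_simp, one_smul]
  · rw [AlgEquiv.symm_apply_eq, hφy, hφyi, hLki]
  · rw [AlgEquiv.symm_apply_eq, map_smul, map_mul, map_mul, map_mul, map_mul, A1, hφyi, hLki,
      map_mul, map_mul, hφyi, mul_smul_comm, smul_mul_assoc, smul_smul]
    rw [show (θ ^ 2)⁻¹ * q * (θ ^ 2 * q⁻¹) = 1 by field_simp, one_smul, mul_assoc _ _ (K : A), mul_assoc _ _ (K : A),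
      Units.inv_mul, mul_one, Units.mul_inv_cancel_left]

/-- the Lusztig automorphism L and its inverse, described through the
primary identification φ of type (θ, t), acting on n_x, y, n_z. -/
theorem stmt5 (hq : q ≠ 0) (hroot : ∀ n : ℕ, 0 < n → q ^ n ≠ 1)
    (θ : F) (hθ : θ ≠ 0) (t : ℤ)
    (φ : Ueq F q ≃ₐ[F] Uq F q)
    (hφx : φ (ux F q) = uki F q -
      (q ^ (1 + t) * (q - q⁻¹) * θ⁻¹) • (((kU F q ^ (-1 - t) : (Uq F q)ˣ) : Uq F q) * ue F q))
    (hφy : φ (uy F q) = uk F q)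
    (hφyi : φ (uyi F q) = uki F q)
    (hφz : φ (uz F q) = uki F q +
      (q ^ (-t) * (q - q⁻¹) * θ) • (uf F q * ((kU F q ^ t : (Uq F q)ˣ) : Uq F q)))
    (L : Uq F q ≃ₐ[F] Uq F q)
    (hLe : L (ue F q) = -(uf F q * uk F q))
    (hLf : L (uf F q) = -(uki F q * ue F q))
    (hLk : L (uk F q) = uki F q)
    (hLki : L (uki F q) = uk F q)
    (nx nz : Ueq F q)
    (hnx : nx = (q / (q - q⁻¹)) • (1 - uy F q * uz F q))
    (hnz : nz = (q / (q - q⁻¹)) • (1 - ux F q * uy F q)) :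
    L (φ nx) = (θ ^ 2 * q⁻¹) • φ (uyi F q * nz * uyi F q) ∧
    L (φ (uy F q)) = φ (uyi F q) ∧
    L (φ nz) = ((θ ^ 2)⁻¹ * q) • φ nx ∧
    L.symm (φ nx) = (θ ^ 2 * q⁻¹) • φ nz ∧
    L.symm (φ (uy F q)) = φ (uyi F q) ∧
    L.symm (φ nz) = ((θ ^ 2)⁻¹ * q) • φ (uyi F q * nx * uyi F q) := by
  have hd : q - q⁻¹ ≠ 0 := by
    intro h
    apply hroot 2 (by norm_num)
    have h1 : q = q⁻¹ := sub_eq_zero.mp h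
    calc q ^ 2 = q * q := pow_two q
      _ = q * q⁻¹ := by rw [← h1]
      _ = 1 := mul_inv_cancel₀ hq
  have hKv : ((kU F q : (Uq F q)ˣ) : Uq F q) = uk F q := rfl
  have hKi : (((kU F q)⁻¹ : (Uq F q)ˣ) : Uq F q) = uki F q := rfl
  have he : ((kU F q : (Uq F q)ˣ) : Uq F q) * ue F q = (q ^ 2) • (ue F q * (kU F q : (Uq F q)ˣ)) := by
    have h := RingQuot.mkAlgHom_rel F (ChevRel.ke (F := F) (q := q))
    rw [map_mul, map_smul, map_mul] at h
    exact h
  have hf : ((kU F q : (Uq F q)ˣ) : Uq F q) * uf F q = (q⁻¹ ^ 2) • (uf F q * (kU F q : (Uq F q)ˣ)) := by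
    have h := RingQuot.mkAlgHom_rel F (ChevRel.kf (F := F) (q := q))
    rw [map_mul, map_smul, map_mul] at h
    exact h
  exact main_aux q hq hd θ hθ t φ L (kU F q) (ue F q) (uf F q) _ _ _ _ hφx hφy hφyi hφz
    hLe hLf hLk hLki he hf nx nz hnx hnz

end Lusztig
end

section
/- For every finite-dimensional U_eq-module V, the actions of n_x, n_y, and n_z on V are nilpotent endomorphisms. -/
namespace Lusztig

variable (F : Type*) [Field F] (q : F)



theorem exists_zero_aux {F : Type*} [Field F] {V : Type*} [AddCommGroup V] [Module F V]
    [FiniteDimensional F V] (f : Module.End F V) (c : F) (hc : c ≠ 0)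
    (hroot : ∀ n : ℕ, 0 < n → c ^ n ≠ 1) (v : ℕ → V) (h : ∀ n, f (v n) = c ^ n • v n) :
    ∃ n, v n = 0 := by
  by_contra! hv
  have key : ∀ m n : ℕ, m < n → c ^ m ≠ c ^ n := by
    intro m n hlt he
    apply hroot (n - m) (by omega)
    have h2 : c ^ n = c ^ m * c ^ (n - m) := by rw [← pow_add]; congr 1; omega
    rw [h2] at he
    have := mul_left_cancel₀ (pow_ne_zero m hc) ((mul_one _).trans he)
    exact this.symm
  have inj : Function.Injective (fun n : ℕ => c ^ n) := by
    intro m n he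
    rcases lt_trichotomy m n with hl | hl | hl
    · exact absurd he (key _ _ hl)
    · exact hl
    · exact absurd he.symm (key _ _ hl)
  have li := Module.End.eigenvectors_linearIndependent' f (fun n : ℕ => c ^ n) inj v
    (fun n => ⟨Module.End.mem_eigenspace_iff.2 (h n), hv n⟩)
  have := li.finite
  exact not_finite ℕ

theorem nilp_aux {F : Type*} [Field F] {V : Type*} [AddCommGroup V] [Module F V]
    [FiniteDimensional F V] (A B C : Module.End F V) (c : F) (hc : c ≠ 0)
    (hroot : ∀ n : ℕ, 0 < n → c ^ n ≠ 1) (hAC : A * C = 1)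
    (h : A * B = c • (B * A)) : IsNilpotent B := by
  have hp : ∀ n : ℕ, A * B ^ n = c ^ n • (B ^ n * A) := by
    intro n
    induction n with
    | zero => simp
    | succ k ih =>
      rw [pow_succ, ← mul_assoc, ih, smul_mul_assoc, mul_assoc, h, mul_smul_comm, smul_smul,
        ← pow_succ, mul_assoc]
  obtain ⟨n, hn⟩ := exists_zero_aux
    ((LinearMap.mulLeft F A) * (LinearMap.mulRight F C)) c hc hroot (fun n => B ^ n) (by
      intro n
      simp only [Module.End.mul_apply, LinearMap.mulLeft_apply, LinearMap.mulRight_apply]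
      rw [← mul_assoc, hp, smul_mul_assoc, mul_assoc, hAC, mul_one])
  exact ⟨n, hn⟩

theorem rel_aux {F : Type*} [Field F] {A : Type*} [Ring A] [Algebra F A] (q : F) (hq : q ≠ 0)
    (hd : q - q⁻¹ ≠ 0) (a b : A)
    (h : (q - q⁻¹)⁻¹ • (q • (a * b) - q⁻¹ • (b * a)) = 1) :
    1 - b * a = q ^ 2 • (1 - a * b) := by
  have h1 : q • (a * b) - q⁻¹ • (b * a) = (q - q⁻¹) • (1 : A) := by
    rw [← h, smul_smul, mul_inv_cancel₀ hd, one_smul]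
  have h2 := congrArg (fun t => q • t) h1
  simp only [smul_sub, sub_smul, smul_smul, mul_inv_cancel₀ hq, one_smul] at h2
  rw [smul_sub, pow_two]
  have h3 : b * a = (q * q) • (a * b) - ((q * q) • (1 : A) - 1) := by
    rw [← h2]; abel
  rw [h3]; abel

theorem mul_left_aux {F : Type*} [Field F] {A : Type*} [Ring A] [Algebra F A] (c : F) (a b : A)
    (h : 1 - b * a = c • (1 - a * b)) : (1 - a * b) * a = c • (a * (1 - a * b)) := by
  rw [← mul_smul_comm, ← h]; noncomm_ring

theorem mul_right_aux {F : Type*} [Field F] {A : Type*} [Ring A] [Algebra F A] (c : F) (a b : A)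
    (h : 1 - b * a = c • (1 - a * b)) : b * (1 - a * b) = c • ((1 - a * b) * b) := by
  rw [← smul_mul_assoc, ← h]; noncomm_ring

/-- on every finite-dimensional module for the equitable algebra, the
elements n_x = q(1 − yz)/(q − q⁻¹), n_y = q(1 − zx)/(q − q⁻¹), n_z = q(1 − xy)/(q − q⁻¹)
act as nilpotent endomorphisms. -/
theorem stmt6 (hq : q ≠ 0) (hroot : ∀ n : ℕ, 0 < n → q ^ n ≠ 1)
    (V : Type*) [AddCommGroup V] [Module F V] [FiniteDimensional F V]
    (ρ : Ueq F q →ₐ[F] Module.End F V) :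
    IsNilpotent (ρ ((q / (q - q⁻¹)) • (1 - uy F q * uz F q))) ∧
    IsNilpotent (ρ ((q / (q - q⁻¹)) • (1 - uz F q * ux F q))) ∧
    IsNilpotent (ρ ((q / (q - q⁻¹)) • (1 - ux F q * uy F q))) := by
  have hd : q - q⁻¹ ≠ 0 := by
    intro h
    apply hroot 2 (by norm_num)
    have : q = q⁻¹ := sub_eq_zero.1 h
    rw [pow_two]; nth_rewrite 2 [this]; exact mul_inv_cancel₀ hq
  have hc : q ^ 2 ≠ 0 := pow_ne_zero 2 hq
  have hcr : ∀ n : ℕ, 0 < n → (q ^ 2) ^ n ≠ 1 := by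
    intro n hn; rw [← pow_mul]; exact hroot _ (by omega)
  have hxy : (q - q⁻¹)⁻¹ • (q • (ux F q * uy F q) - q⁻¹ • (uy F q * ux F q)) = 1 := by
    have h := RingQuot.mkAlgHom_rel F (EqRel.xy (F := F) (q := q))
    simpa only [ux, uy, map_mul, map_one, map_smul, map_sub] using h
  have hyz : (q - q⁻¹)⁻¹ • (q • (uy F q * uz F q) - q⁻¹ • (uz F q * uy F q)) = 1 := by
    have h := RingQuot.mkAlgHom_rel F (EqRel.yz (F := F) (q := q))
    simpa only [uz, uy, map_mul, map_one, map_smul, map_sub] using h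
  have hzx : (q - q⁻¹)⁻¹ • (q • (uz F q * ux F q) - q⁻¹ • (ux F q * uz F q)) = 1 := by
    have h := RingQuot.mkAlgHom_rel F (EqRel.zx (F := F) (q := q))
    simpa only [ux, uz, map_mul, map_one, map_smul, map_sub] using h
  have hyyi : ρ (uy F q) * ρ (uyi F q) = 1 := by
    rw [← map_mul, ← map_one ρ]; exact congrArg ρ (yU F q).val_inv
  have hyiy : ρ (uyi F q) * ρ (uy F q) = 1 := by
    rw [← map_mul, ← map_one ρ]; exact congrArg ρ (yU F q).inv_val
  have rxy := congrArg ρ (rel_aux q hq hd _ _ hxy)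
  have ryz := congrArg ρ (rel_aux q hq hd _ _ hyz)
  have rzx := congrArg ρ (rel_aux q hq hd _ _ hzx)
  simp only [map_mul, map_one, map_smul, map_sub] at rxy ryz rzx ⊢
  generalize ρ (ux F q) = x at *
  generalize ρ (uy F q) = y at *
  generalize ρ (uyi F q) = w at *
  generalize ρ (uz F q) = z at *
  refine ⟨IsNilpotent.smul ?_ _, IsNilpotent.smul ?_ _, IsNilpotent.smul ?_ _⟩
  · -- conjugation by the inverse of y
    have h := mul_left_aux _ _ _ ryz
    refine nilp_aux w _ y (q ^ 2) hc hcr hyiy ?_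
    generalize 1 - y * z = M at h
    calc w * M = w * (M * y) * w := by rw [mul_assoc, mul_assoc, hyyi, mul_one]
      _ = q ^ 2 • ((w * y) * M * w) := by
        rw [h, mul_smul_comm, smul_mul_assoc, mul_assoc w y M]
      _ = _ := by rw [hyiy, one_mul]
  · have hl := mul_left_aux _ _ _ rzx
    have hr := mul_right_aux _ _ _ rzx
    have hinj : Function.Injective x := by
      rw [injective_iff_map_eq_zero]
      intro v hv
      by_contra hv0
      have hK0 : (1 - z * x) v = v := by simp [hv]
      have hK : ∀ n : ℕ, (1 - z * x) ((z ^ n) v) = (q ^ 2) ^ n • (z ^ n) v := by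
        intro n
        induction n with
        | zero => simp [hv]
        | succ k ih =>
          have e := LinearMap.congr_fun hl ((z ^ k) v)
          simp only [Module.End.mul_apply (1 - z * x) z, LinearMap.smul_apply,
            Module.End.mul_apply z (1 - z * x)] at e
          rw [pow_succ' z, Module.End.mul_apply z (z ^ k), e, ih, map_smul, smul_smul, pow_succ' (q ^ 2)]
      have hex := exists_zero_aux (1 - z * x) (q ^ 2) hc hcr (fun n => (z ^ n) v) hK
      classical
      have hm := Nat.find_spec hex
      have hmin := fun m => Nat.find_min hex (m := m)
      generalize Nat.find hex = m at hm hmin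
      cases m with
      | zero => exact hv0 (by simpa using hm)
      | succ k =>
        have hk : (z ^ k) v ≠ 0 := hmin k (Nat.lt_succ_self k)
        have hz : z ((z ^ k) v) = 0 := by
          rw [← Module.End.mul_apply, ← pow_succ']; exact hm
        have e := LinearMap.congr_fun rzx ((z ^ k) v)
        rw [LinearMap.smul_apply, hK, smul_smul, ← pow_succ'] at e
        simp only [LinearMap.sub_apply, Module.End.mul_apply, Module.End.one_apply, hz, map_zero,
          sub_zero] at e
        have e2 : ((q ^ 2) ^ (k + 1) - 1) • (z ^ k) v = 0 := by
          rw [sub_smul, one_smul, ← e, sub_self]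
        rcases smul_eq_zero.1 e2 with h | h
        · exact hcr (k + 1) (Nat.succ_pos k) (sub_eq_zero.1 h)
        · exact hk h
    have hu : IsUnit x :=
      (Module.End.isUnit_iff x).2 ⟨hinj, LinearMap.injective_iff_surjective.1 hinj⟩
    obtain ⟨u, rfl⟩ := hu
    exact nilp_aux _ _ _ (q ^ 2) hc hcr u.mul_inv hr
  · exact nilp_aux y _ w (q ^ 2) hc hcr hyyi (mul_right_aux _ _ _ rxy)

end Lusztig
end

section
/- On every nonzero finite-dimensional U_eq-module V, the elements x and z act as invertible endomorphisms of V. -/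
namespace Lusztig

variable (F : Type*) [Field F] (q : F)



theorem aux_unit {F V : Type*} [Field F] [AddCommGroup V] [Module F V] [FiniteDimensional F V]
    (q : F) (hq : q ≠ 0) (hroot : ∀ n : ℕ, 0 < n → q ^ n ≠ 1)
    (A Y Y' : Module.End F V) (h1 : Y * Y' = 1) (h2 : Y' * Y = 1)
    (h : q • (A * Y) - q⁻¹ • (Y * A) = (q - q⁻¹) • (1 : Module.End F V)) : IsUnit A := by
  have hY : IsUnit Y := ⟨⟨Y, Y', h1, h2⟩, rfl⟩
  have hN : ∀ v, (Y * A) v = (q ^ 2) • (A * Y) v - (q ^ 2 - 1) • v := by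
    intro v
    have := congrArg (fun f : Module.End F V => q • f v) h
    simp only [LinearMap.sub_apply, LinearMap.smul_apply, smul_sub, smul_smul,
      Module.End.one_apply, mul_inv_cancel₀ hq, mul_sub, one_smul] at this
    rw [pow_two, ← this]; abel
  by_contra hA
  have hAY : ¬ IsUnit (A * Y) := by
    intro hu
    apply hA
    have : A = (A * Y) * Y' := by rw [mul_assoc, h1, mul_one]
    rw [this]
    exact hu.mul ⟨⟨Y', Y, h2, h1⟩, rfl⟩
  have key : ∀ k : ℕ, Module.End.HasEigenvalue (A * Y) (1 - (q⁻¹ ^ 2) ^ k) := by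
    intro k
    induction k with
    | zero =>
      rw [pow_zero, sub_self, Module.End.hasEigenvalue_iff_mem_spectrum]
      exact spectrum.zero_mem_iff F |>.2 hAY
    | succ k ih =>
      obtain ⟨v, hv⟩ := ih.exists_hasEigenvector
      have hv1 := hv.apply_eq_smul
      refine Module.End.hasEigenvalue_of_hasEigenvector (x := Y v) ⟨?_, ?_⟩
      · rw [Module.End.mem_eigenspace_iff]
        have e := hN (Y v)
        have e2 : (Y * A) (Y v) = (1 - (q⁻¹ ^ 2) ^ k) • Y v := by
          rw [← map_smul, ← hv1]; rfl
        rw [e2] at e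
        have e3 : (q ^ 2) • (A * Y) (Y v) = (q ^ 2 - (q⁻¹ ^ 2) ^ k) • Y v := by
          rw [sub_eq_iff_eq_add.1 e.symm, ← add_smul]; congr 1; ring
        have e4 := congrArg (fun w => (q ^ 2)⁻¹ • w) e3
        simp only [smul_smul] at e4
        rw [inv_mul_cancel₀ (pow_ne_zero 2 hq), one_smul] at e4
        rw [e4]; congr 1
        rw [pow_succ _ k, mul_sub, inv_mul_cancel₀ (pow_ne_zero 2 hq), inv_pow, mul_comm]
      · intro h0
        apply hv.2
        have := congrArg Y' h0
        rw [map_zero] at this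
        rw [← this, ← Module.End.mul_apply, h2]; rfl
  have hinj : Function.Injective (fun k : ℕ => 1 - (q⁻¹ ^ 2) ^ k) := by
    have hlt : ∀ a b : ℕ, a < b → (q⁻¹ ^ 2) ^ a ≠ (q⁻¹ ^ 2) ^ b := by
      intro a b hab he
      apply hroot (2 * (b - a)) (by omega)
      obtain ⟨d, rfl⟩ := Nat.exists_eq_add_of_lt hab
      rw [show a + d + 1 - a = d + 1 by omega]
      rw [add_assoc, pow_add] at he
      have h0 : (q⁻¹ ^ 2) ^ a ≠ 0 := pow_ne_zero _ (pow_ne_zero _ (inv_ne_zero hq))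
      have := mul_left_cancel₀ h0 ((mul_one _).trans he)
      rw [← pow_mul, inv_pow] at this
      exact inv_eq_one.1 this.symm
    intro a b hab
    have hab' := sub_right_injective hab
    rcases lt_trichotomy a b with h | h | h
    · exact absurd hab' (hlt _ _ h)
    · exact h
    · exact absurd hab'.symm (hlt _ _ h)
  exact Set.infinite_of_injective_forall_mem hinj (s := {μ | Module.End.HasEigenvalue (A * Y) μ}) key
    (Module.End.finite_hasEigenvalue _)

/-- on every nonzero finite-dimensional module for the equitable algebra,
the elements x and z act as invertible endomorphisms. -/
theorem stmt7 (hq : q ≠ 0) (hroot : ∀ n : ℕ, 0 < n → q ^ n ≠ 1)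
    (V : Type*) [AddCommGroup V] [Module F V] [FiniteDimensional F V] [Nontrivial V]
    (ρ : Ueq F q →ₐ[F] Module.End F V) :
    IsUnit (ρ (ux F q)) ∧ IsUnit (ρ (uz F q)) := by
  have hqq : q - q⁻¹ ≠ 0 := by
    intro h
    apply hroot 2 (by norm_num)
    have := sub_eq_zero.1 h
    rw [pow_two]; nth_rewrite 1 [this]; exact inv_mul_cancel₀ hq
  have h1 : ρ (uy F q) * ρ (uyi F q) = 1 := by
    rw [← map_mul, ← map_one ρ]; exact congrArg ρ (yU F q).val_inv
  have h2 : ρ (uyi F q) * ρ (uy F q) = 1 := by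
    rw [← map_mul, ← map_one ρ]; exact congrArg ρ (yU F q).inv_val
  have hx := congrArg ρ (RingQuot.mkAlgHom_rel F (EqRel.xy (F := F) (q := q)))
  have hz := congrArg ρ (RingQuot.mkAlgHom_rel F (EqRel.yz (F := F) (q := q)))
  simp only [map_smul, map_sub, map_mul, map_one] at hx hz
  rw [inv_smul_eq_iff₀ hqq] at hx hz
  refine ⟨aux_unit q hq hroot _ _ _ h1 h2 hx, aux_unit q⁻¹ (inv_ne_zero hq) ?_ _ _ _ h1 h2 ?_⟩
  · intro n hn h
    rw [inv_pow] at h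
    exact hroot n hn (inv_eq_one.1 h)
  · rw [inv_inv, ← neg_sub q, neg_smul, ← neg_sub (q • _)]
    exact congrArg Neg.neg hz

end Lusztig
end

section
/- Let V be a finite-dimensional F-vector space and let φ ∈ End(V) be nilpotent. Then exp_q(q² φ) ∘ (1 − (q² − 1)φ) = exp_q(φ). -/
namespace Lusztig

variable (F : Type*) [Field F] (q : F)



/-- The q-integer [n]_q = (qⁿ − q⁻ⁿ)/(q − q⁻¹). -/
noncomputable def qInt (n : ℤ) : F := (q ^ n - q ^ (-n)) / (q - q⁻¹)

/-- The q-factorial [n]!_q = [n]_q [n−1]_q ⋯ [1]_q, with [0]!_q = 1. -/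
noncomputable def qFact (n : ℕ) : F := ∏ i ∈ Finset.range n, qInt F q ((i : ℤ) + 1)

/-- The q-exponential exp_q(φ) = Σ_{i≥0} q^{binom(i,2)} φ^i / [i]!_q of a nilpotent
endomorphism φ of a finite-dimensional space.  Since the nilpotency index of φ is at most
`finrank F V`, the series may be truncated at `finrank F V + 1` terms. -/
noncomputable def expq {V : Type*} [AddCommGroup V] [Module F V] (φ : Module.End F V) :
    Module.End F V :=
  ∑ i ∈ Finset.range (Module.finrank F V + 1), (q ^ (i.choose 2) / qFact F q i) • φ ^ i

/-- The inverse of the q-exponential: exp_{q⁻¹}(−φ) = Σ_{i≥0} (−1)^i q^{−binom(i,2)} φ^i / [i]!_q. -/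
noncomputable def expqInv {V : Type*} [AddCommGroup V] [Module F V] (φ : Module.End F V) :
    Module.End F V :=
  ∑ i ∈ Finset.range (Module.finrank F V + 1),
    (((-1 : F) ^ i * (q ^ (i.choose 2))⁻¹) / qFact F q i) • φ ^ i

/-- The q-exponential for square matrices (truncated at n + 1 terms, which is enough
for nilpotent matrices). -/
noncomputable def expqM {n : ℕ} (φ : Matrix (Fin n) (Fin n) F) : Matrix (Fin n) (Fin n) F :=
  ∑ i ∈ Finset.range (n + 1), (q ^ (i.choose 2) / qFact F q i) • φ ^ i


theorem coef_step (hq : q ≠ 0) (hroot : ∀ n : ℕ, 0 < n → q ^ n ≠ 1) (n : ℕ) :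
    ((q ^ 2) ^ (n + 1) - 1) * (q ^ ((n + 1).choose 2) / qFact F q (n + 1)) =
      (q ^ 2 - 1) * (q ^ 2) ^ n * (q ^ (n.choose 2) / qFact F q n) := by
  have h1 : (q ^ 2) ^ (n + 1) - 1 ≠ 0 := by
    rw [← pow_mul]
    exact sub_ne_zero.mpr (hroot _ (by positivity))
  have h2 : q ^ 2 - 1 ≠ 0 := sub_ne_zero.mpr (hroot 2 (by norm_num))
  have hI : qInt F q ((n : ℤ) + 1) =
      ((q ^ 2) ^ (n + 1) - 1) / ((q ^ 2 - 1) * q ^ n) := by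
    have e : q - q⁻¹ = (q ^ 2 - 1) / q := by field_simp
    have e2 : q ^ ((n : ℤ) + 1) - q ^ (-((n : ℤ) + 1)) = ((q ^ 2) ^ (n + 1) - 1) / q ^ (n + 1) := by
      rw [zpow_neg, show ((n : ℤ) + 1) = ((n + 1 : ℕ) : ℤ) by push_cast; rfl, zpow_natCast]
      have : q ^ (n + 1) ≠ 0 := pow_ne_zero _ hq
      rw [pow_right_comm]
      field_simp
    unfold qInt
    rw [e, e2]
    rw [pow_succ q n]
    have : q ^ n ≠ 0 := pow_ne_zero _ hq
    field_simp
  have hF : qFact F q (n + 1) = qFact F q n * qInt F q ((n : ℤ) + 1) := by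
    unfold qFact
    rw [Finset.prod_range_succ]
  have hc : (n + 1).choose 2 = n + n.choose 2 := by
    rw [Nat.choose_succ_succ' n 1, Nat.choose_one_right]
  rw [hF, hI, hc, pow_add q n]
  have hn : q ^ n ≠ 0 := pow_ne_zero _ hq
  clear hI hF hc hroot
  revert h1
  generalize (q ^ 2) ^ (n + 1) - 1 = d
  intro h1
  rw [pow_right_comm q 2 n]
  generalize q ^ (n.choose 2) = e
  revert hn
  generalize q ^ n = x
  intro hn
  by_cases h0 : qFact F q n = 0
  · simp [h0]
  · field_simp

theorem partial_sum (hq : q ≠ 0) (hroot : ∀ n : ℕ, 0 < n → q ^ n ≠ 1)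
    {V : Type*} [AddCommGroup V] [Module F V] (φ : Module.End F V) (n : ℕ) :
    (∑ i ∈ Finset.range (n + 1), (q ^ (i.choose 2) / qFact F q i) • ((q ^ 2) • φ) ^ i) *
      (1 - (q ^ 2 - 1) • φ) =
    (∑ i ∈ Finset.range (n + 1), (q ^ (i.choose 2) / qFact F q i) • φ ^ i) -
      ((q ^ 2 - 1) * (q ^ 2) ^ n * (q ^ (n.choose 2) / qFact F q n)) • φ ^ (n + 1) := by
  induction n with
  | zero => simp [qFact]
  | succ n ih =>
    rw [Finset.sum_range_succ, add_mul, ih, Finset.sum_range_succ _ (n + 1),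
      ← coef_step F q hq hroot n]
    generalize q ^ ((n + 1).choose 2) / qFact F q (n + 1) = c
    rw [smul_pow, mul_sub, mul_one, smul_smul, smul_mul_smul_comm, ← pow_succ]
    module

/-- exp_q(q² φ) ∘ (1 − (q² − 1) φ) = exp_q(φ) for a nilpotent endomorphism φ
of a finite-dimensional vector space. -/
theorem stmt8 (hq : q ≠ 0) (hroot : ∀ n : ℕ, 0 < n → q ^ n ≠ 1)
    (V : Type*) [AddCommGroup V] [Module F V] [FiniteDimensional F V]
    (φ : Module.End F V) (hφ : IsNilpotent φ) :
    expq F q ((q ^ 2) • φ) * (1 - (q ^ 2 - 1) • φ) = expq F q φ := by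
  have h : φ ^ (Module.finrank F V + 1) = 0 := by
    have h0 : φ ^ Module.finrank F V = 0 := by
      simpa only [(LinearMap.isNilpotent_iff_charpoly φ).1 hφ, map_pow,
        Polynomial.aeval_X] using φ.aeval_self_charpoly
    rw [pow_succ, h0, zero_mul]
  unfold expq
  rw [partial_sum F q hq hroot, h, smul_zero, sub_zero]

end Lusztig
end

section
/- Let V be a nonzero finite-dimensional F-vector space, and let x, y, z ∈ End(V) with y invertible satisfy q x y − q⁻¹ y x = (q − q⁻¹)·1, q y z − q⁻¹ z y = (q − q⁻¹)·1, q z x − q⁻¹ x z = (q − q⁻¹)·1. Assume n_z := q(1 − x y)/(q − q⁻¹) is nilpotent and x is invertible. Then exp_q(n_z)⁻¹ ∘ y ∘ exp_q(n_z) = x⁻¹. -/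
namespace Lusztig

variable (F : Type*) [Field F] (q : F)



open PowerSeries in
/-- evaluation of a power series at a nilpotent endomorphism, truncated -/
noncomputable def evq {F : Type*} [Field F] {V : Type*} [AddCommGroup V] [Module F V] (N : ℕ)
    (n : Module.End F V) (f : PowerSeries F) : Module.End F V :=
  Polynomial.aeval n (PowerSeries.trunc N f)

theorem evq_sum {F : Type*} [Field F] {V : Type*} [AddCommGroup V] [Module F V] (N : ℕ)
    (n : Module.End F V) (f : PowerSeries F) :
    evq N n f = ∑ i ∈ Finset.range N, (PowerSeries.coeff i f) • n ^ i := by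
  unfold evq
  rw [Polynomial.aeval_def, PowerSeries.eval₂_trunc_eq_sum_range]
  refine Finset.sum_congr rfl fun i _ => ?_
  rw [Algebra.smul_def]

theorem evq_coe {F : Type*} [Field F] {V : Type*} [AddCommGroup V] [Module F V] (N : ℕ)
    (n : Module.End F V) (hn : n ^ N = 0) (p : Polynomial F) :
    evq N n (p : PowerSeries F) = Polynomial.aeval n p := by
  rw [evq_sum, Polynomial.aeval_eq_sum_range' (n := N + (p.natDegree + 1)) (by omega),
    Finset.sum_range_add]
  simp [pow_add, hn]

theorem evq_mul {F : Type*} [Field F] {V : Type*} [AddCommGroup V] [Module F V] (N : ℕ)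
    (n : Module.End F V) (hn : n ^ N = 0) (f g : PowerSeries F) :
    evq N n (f * g) = evq N n f * evq N n g := by
  have h := evq_coe N n hn (PowerSeries.trunc N f * PowerSeries.trunc N g)
  rw [map_mul] at h
  rw [show evq N n f * evq N n g = _ from h.symm]
  unfold evq
  rw [Polynomial.coe_mul, PowerSeries.trunc_trunc_mul_trunc]

theorem evq_rescale {F : Type*} [Field F] {V : Type*} [AddCommGroup V] [Module F V] (N : ℕ)
    (n y : Module.End F V) (a : F) (h : y * n = a • (n * y)) (f : PowerSeries F) :
    y * evq N n f = evq N n (PowerSeries.rescale a f) * y := by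
  have hp : ∀ i : ℕ, y * n ^ i = a ^ i • (n ^ i * y) := by
    intro i
    induction i with
    | zero => simp
    | succ k ih =>
      rw [pow_succ, ← mul_assoc, ih, smul_mul_assoc, mul_assoc, h, mul_smul_comm, smul_smul,
        ← pow_succ, mul_assoc]
  rw [evq_sum, evq_sum, Finset.mul_sum, Finset.sum_mul]
  refine Finset.sum_congr rfl fun i _ => ?_
  rw [mul_smul_comm, hp, PowerSeries.coeff_rescale, smul_smul, smul_mul_assoc, mul_comm]

theorem q_sub_ne {F : Type*} [Field F] (q : F) (hq : q ≠ 0)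
    (hroot : ∀ n : ℕ, 0 < n → q ^ n ≠ 1) : q - q⁻¹ ≠ 0 := by
  intro h
  apply hroot 2 (by norm_num)
  have : q = q⁻¹ := sub_eq_zero.mp h
  rw [pow_two]
  nth_rewrite 2 [this]
  exact mul_inv_cancel₀ hq

theorem qInt_mul {F : Type*} [Field F] (q : F) (hq : q ≠ 0)
    (hroot : ∀ n : ℕ, 0 < n → q ^ n ≠ 1) (i : ℕ) :
    (q ^ 2 - 1) * q ^ i * qInt F q ((i : ℤ) + 1) = (q ^ 2) ^ (i + 1) - 1 := by
  have h := q_sub_ne q hq hroot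
  have e : q ^ 2 - 1 = q * (q - q⁻¹) := by field_simp
  unfold qInt
  rw [e, zpow_neg, show ((i : ℤ) + 1) = ((i + 1 : ℕ) : ℤ) by push_cast; rfl, zpow_natCast]
  have e2 : q * (q - q⁻¹) * q ^ i * ((q ^ (i + 1) - (q ^ (i + 1))⁻¹) / (q - q⁻¹))
     = q ^ (i + 1) * (q ^ (i + 1) - (q ^ (i + 1))⁻¹) := by
    generalize q - q⁻¹ = d at *
    rw [mul_div_assoc', div_eq_iff h]
    ring
  rw [e2, mul_sub, mul_inv_cancel₀ (pow_ne_zero _ hq)]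
  ring

theorem qInt_ne {F : Type*} [Field F] (q : F) (hq : q ≠ 0)
    (hroot : ∀ n : ℕ, 0 < n → q ^ n ≠ 1) (i : ℕ) : qInt F q ((i : ℤ) + 1) ≠ 0 := by
  intro h
  have := qInt_mul q hq hroot i
  rw [h, mul_zero, ← pow_mul] at this
  exact hroot (2 * (i + 1)) (by omega) (sub_eq_zero.mp this.symm)

theorem qFact_ne {F : Type*} [Field F] (q : F) (hq : q ≠ 0)
    (hroot : ∀ n : ℕ, 0 < n → q ^ n ≠ 1) (i : ℕ) : qFact F q i ≠ 0 :=
  Finset.prod_ne_zero_iff.mpr fun j _ => qInt_ne q hq hroot j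

theorem qFact_succ {F : Type*} [Field F] (q : F) (i : ℕ) :
    qFact F q (i + 1) = qFact F q i * qInt F q ((i : ℤ) + 1) :=
  Finset.prod_range_succ _ _

noncomputable def serA {F : Type*} [Field F] (q : F) : PowerSeries F :=
  PowerSeries.mk fun i => q ^ (i.choose 2) / qFact F q i

noncomputable def serB {F : Type*} [Field F] (q : F) : PowerSeries F :=
  PowerSeries.mk fun i => ((-1 : F) ^ i * (q ^ (i.choose 2))⁻¹) / qFact F q i

theorem choose_two_succ (i : ℕ) : (i + 1).choose 2 = i + i.choose 2 := by
  rw [Nat.choose_succ_succ' i 1, Nat.choose_one_right]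

theorem serA_eq {F : Type*} [Field F] (q : F) (hq : q ≠ 0)
    (hroot : ∀ n : ℕ, 0 < n → q ^ n ≠ 1) :
    PowerSeries.rescale (q ^ 2) (serA q) * (1 - PowerSeries.C (q ^ 2 - 1) * PowerSeries.X)
      = serA q := by
  ext i
  rw [mul_sub, mul_one, mul_left_comm, map_sub, PowerSeries.coeff_C_mul, PowerSeries.coeff_rescale]
  cases i with
  | zero => simp
  | succ k =>
    rw [PowerSeries.coeff_succ_mul_X, PowerSeries.coeff_rescale]
    simp only [serA, PowerSeries.coeff_mk, choose_two_succ, qFact_succ]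
    have h1 := qInt_mul q hq hroot k
    have h2 := qInt_ne q hq hroot k
    have h3 := qFact_ne q hq hroot k
    generalize qInt F q ((k : ℤ) + 1) = t at *
    generalize qFact F q k = u at *
    have h4 : (q ^ 2) ^ (k + 1) = 1 + (q ^ 2 - 1) * q ^ k * t := by rw [h1]; ring
    rw [h4]
    field_simp
    ring

theorem serB_eq {F : Type*} [Field F] (q : F) (hq : q ≠ 0)
    (hroot : ∀ n : ℕ, 0 < n → q ^ n ≠ 1) :
    PowerSeries.rescale (q ^ 2) (serB q)
      = serB q * (1 - PowerSeries.C (q ^ 2 - 1) * PowerSeries.X) := by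
  ext i
  rw [mul_sub, mul_one, mul_left_comm, map_sub, PowerSeries.coeff_C_mul, PowerSeries.coeff_rescale]
  cases i with
  | zero => simp
  | succ k =>
    rw [PowerSeries.coeff_succ_mul_X]
    simp only [serB, PowerSeries.coeff_mk, choose_two_succ, qFact_succ]
    have h1 := qInt_mul q hq hroot k
    have h2 := qInt_ne q hq hroot k
    have h3 := qFact_ne q hq hroot k
    generalize qInt F q ((k : ℤ) + 1) = t at *
    generalize qFact F q k = u at *
    have h4 : (q ^ 2) ^ (k + 1) = 1 + (q ^ 2 - 1) * q ^ k * t := by rw [h1]; ring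
    rw [h4, pow_add q k, pow_succ (-1 : F)]
    field_simp
    ring

theorem serBA {F : Type*} [Field F] (q : F) (hq : q ≠ 0)
    (hroot : ∀ n : ℕ, 0 < n → q ^ n ≠ 1) : serB q * serA q = 1 := by
  have h : PowerSeries.rescale (q ^ 2) (serB q * serA q) = serB q * serA q := by
    rw [map_mul, serB_eq q hq hroot, mul_assoc, mul_comm _ (PowerSeries.rescale _ _),
      serA_eq q hq hroot]
  ext i
  cases i with
  | zero =>
    simp [serA, serB, qFact]
  | succ k =>
    have h1 := congrArg (PowerSeries.coeff (k + 1)) h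
    rw [PowerSeries.coeff_rescale, ← sub_eq_zero, ← sub_one_mul] at h1
    rw [PowerSeries.coeff_one, if_neg (by omega)]
    refine (mul_eq_zero.mp h1).resolve_left ?_
    rw [← pow_mul]
    exact sub_ne_zero.mpr (hroot _ (by omega))

/-- exp_q(n_z)⁻¹ ∘ y ∘ exp_q(n_z) = x⁻¹. -/
theorem stmt9 (hq : q ≠ 0) (hroot : ∀ n : ℕ, 0 < n → q ^ n ≠ 1)
    (V : Type*) [AddCommGroup V] [Module F V] [FiniteDimensional F V] [Nontrivial V]
    (x y z : Module.End F V) (hy : IsUnit y)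
    (hxy : q • (x * y) - q⁻¹ • (y * x) = (q - q⁻¹) • (1 : Module.End F V))
    (hyz : q • (y * z) - q⁻¹ • (z * y) = (q - q⁻¹) • (1 : Module.End F V))
    (hzx : q • (z * x) - q⁻¹ • (x * z) = (q - q⁻¹) • (1 : Module.End F V))
    (nz : Module.End F V) (hnz : nz = (q / (q - q⁻¹)) • (1 - x * y))
    (hnil : IsNilpotent nz) (hx : IsUnit x) :
    expqInv F q nz * y * expq F q nz = Ring.inverse x := by
  have hd := q_sub_ne q hq hroot
  have hn0 : nz ^ (Module.finrank F V + 1) = 0 := by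
    obtain ⟨k, hk⟩ := hnil
    have := Module.End.ker_pow_le_ker_pow_finrank nz k
    rw [hk, LinearMap.ker_zero, top_le_iff, LinearMap.ker_eq_top] at this
    rw [pow_succ, this, zero_mul]
  have hA : expq F q nz = evq (Module.finrank F V + 1) nz (serA q) := by
    rw [evq_sum]; simp [expq, serA]
  have hB : expqInv F q nz = evq (Module.finrank F V + 1) nz (serB q) := by
    rw [evq_sum]; simp [expqInv, serB]
  have hyx : y * x = 1 - (q ^ 2) • (1 - x * y) := by
    have h := congrArg (fun t => q • t) hxy
    simp only [smul_sub, smul_smul, mul_sub, sub_smul, mul_inv_cancel₀ hq, one_smul] at h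
    rw [smul_sub, pow_two]
    rw [sub_eq_iff_eq_add] at h
    rw [h]; abel
  have hcomm : y * nz = (q ^ 2) • (nz * y) := by
    have e : y * (1 - x * y) = (1 - y * x) * y := by noncomm_ring
    rw [hnz, mul_smul_comm, e, hyx, sub_sub_cancel, smul_mul_assoc, smul_mul_assoc, smul_comm]
  have hX : evq (Module.finrank F V + 1) nz
      (1 - PowerSeries.C (q ^ 2 - 1) * PowerSeries.X) = y * x := by
    have h := evq_coe _ nz hn0 (1 - Polynomial.C (q ^ 2 - 1) * Polynomial.X)
    simp only [Polynomial.coe_sub, Polynomial.coe_mul, Polynomial.coe_one, Polynomial.coe_C,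
      Polynomial.coe_X] at h
    rw [h, hyx, hnz]
    simp only [map_sub, map_mul, map_one, Polynomial.aeval_C, Polynomial.aeval_X]
    rw [← map_one (algebraMap F (Module.End F V)), ← map_sub, ← Algebra.smul_def, smul_smul]
    congr 2
    have e : q ^ 2 - 1 = q * (q - q⁻¹) := by field_simp
    rw [e, mul_div_assoc', div_eq_iff hd]; ring
  have hBA : expqInv F q nz * expq F q nz = 1 := by
    rw [hA, hB, ← evq_mul _ _ hn0, serBA q hq hroot]
    have h := evq_coe _ nz hn0 1
    simpa using h
  have key : y * expq F q nz * x = expq F q nz := by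
    rw [hA, evq_rescale _ nz y _ hcomm, mul_assoc, ← hX, ← evq_mul _ _ hn0, serA_eq q hq hroot]
  have : expqInv F q nz * y * expq F q nz * x = 1 := by
    rw [mul_assoc, mul_assoc, ← mul_assoc y, key, hBA]
  calc _ = expqInv F q nz * y * expq F q nz * (x * Ring.inverse x) := by
        rw [Ring.mul_inverse_cancel x hx, mul_one]
    _ = _ := by rw [← mul_assoc, this, one_mul]

end Lusztig
end

section
/- In U_eq, for every integer i ≥ 1: z n_z^i − n_z^i z = q^{1−i} [i]_q (n_z^{i−1} x − y n_z^{i−1}). -/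
namespace Lusztig

variable (F : Type*) [Field F] (q : F)



theorem aux_ind {A : Type*} [Ring A] [Algebra F A] (p : F) (x y z n : A)
    (h1 : z * n - n * z = x - y) (hx : x * n = p • (n * x)) (hy : n * y = p • (y * n)) (k : ℕ) :
    z * n ^ (k + 1) - n ^ (k + 1) * z =
      (∑ j ∈ Finset.range (k + 1), p ^ j) • (n ^ k * x - y * n ^ k) := by
  have hyk : ∀ k : ℕ, n ^ k * y = p ^ k • (y * n ^ k) := by
    intro k
    induction k with
    | zero => simp
    | succ k ih =>
      rw [pow_succ, mul_assoc, hy, mul_smul_comm, ← mul_assoc, ih, smul_mul_assoc, smul_smul,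
        mul_assoc, pow_succ, mul_comm p]
  induction k with
  | zero => simpa using h1
  | succ k ih =>
    have e : z * n ^ (k + 1 + 1) - n ^ (k + 1 + 1) * z =
        (z * n ^ (k + 1) - n ^ (k + 1) * z) * n + n ^ (k + 1) * (z * n - n * z) := by
      rw [pow_succ n (k + 1)]; noncomm_ring
    have e2 : (n ^ k * x - y * n ^ k) * n = p • (n ^ (k + 1) * x) - y * n ^ (k + 1) := by
      rw [sub_mul, mul_assoc, hx, mul_smul_comm, pow_succ, mul_assoc, mul_assoc]
    rw [e, ih, h1, smul_mul_assoc, e2, mul_sub, hyk (k + 1)]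
    have g : (∑ j ∈ Finset.range (k + 1), p ^ j) * p + 1
        = ∑ j ∈ Finset.range (k + 1 + 1), p ^ j := by
      rw [Finset.sum_range_succ' _ (k + 1), Finset.sum_mul]; simp [pow_succ]
    rw [smul_sub, smul_sub, smul_smul]
    nth_rewrite 1 [← g]
    rw [Finset.sum_range_succ _ (k + 1), add_smul, add_smul, one_smul]
    abel

theorem aux_base {A : Type*} [Ring A] [Algebra F A] (hq : q ≠ 0) (hd : q - q⁻¹ ≠ 0) (x y z n : A)
    (hxy : (q - q⁻¹)⁻¹ • (q • (x * y) - q⁻¹ • (y * x)) = 1)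
    (hyz : (q - q⁻¹)⁻¹ • (q • (y * z) - q⁻¹ • (z * y)) = 1)
    (hzx : (q - q⁻¹)⁻¹ • (q • (z * x) - q⁻¹ • (x * z)) = 1)
    (hn : n = (q / (q - q⁻¹)) • (1 - x * y)) :
    z * n - n * z = x - y ∧ x * n = (q⁻¹ ^ 2) • (n * x) ∧ n * y = (q⁻¹ ^ 2) • (y * n) := by
  have hd' : q ^ 2 - 1 ≠ 0 := by
    intro h
    apply hd
    field_simp
    linear_combination h
  have key : ∀ a b : A, (q - q⁻¹)⁻¹ • (q • a - q⁻¹ • b) = 1 →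
      a = ((q - q⁻¹) / q) • (1 : A) + (q⁻¹ ^ 2) • b := by
    intro a b h
    rw [← h]
    match_scalars <;> field_simp <;> ring
  have hxy' := key _ _ hxy
  have hyz' := key _ _ hyz
  have hzx' := key _ _ hzx
  have h1 : 1 - x * y = (q⁻¹ ^ 2) • (1 - y * x) := by
    rw [hxy']
    match_scalars <;> field_simp <;> ring
  refine ⟨?_, ?_, ?_⟩
  · have a1 : z * (x * y) = ((q - q⁻¹) / q) • y + (q⁻¹ ^ 2) • (x * z * y) := by
      rw [← mul_assoc, hzx', add_mul, smul_mul_assoc, smul_mul_assoc, one_mul]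
    have a2 : (x * y) * z = ((q - q⁻¹) / q) • x + (q⁻¹ ^ 2) • (x * z * y) := by
      rw [mul_assoc, hyz', mul_add, mul_smul_comm, mul_smul_comm, mul_one, mul_assoc]
    rw [hn, mul_smul_comm, smul_mul_assoc, mul_sub, sub_mul, a1, a2, mul_one, one_mul]
    match_scalars <;> field_simp <;> ring
  · have b : x * (1 - x * y) = (q⁻¹ ^ 2) • ((1 - x * y) * x) := by
      conv_lhs => rw [h1]
      rw [mul_smul_comm]; congr 1; noncomm_ring
    rw [hn, mul_smul_comm, b, smul_mul_assoc, smul_comm]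
  · have b : (1 - x * y) * y = (q⁻¹ ^ 2) • (y * (1 - x * y)) := by
      conv_lhs => rw [h1]
      rw [smul_mul_assoc]; congr 1; noncomm_ring
    rw [hn, mul_smul_comm, smul_mul_assoc, b, smul_comm]

/-- in the equitable algebra,
z n_z^i − n_z^i z = q^{1−i} [i]_q (n_z^{i−1} x − y n_z^{i−1}) for i ≥ 1. -/
theorem stmt10 (hq : q ≠ 0) (hroot : ∀ n : ℕ, 0 < n → q ^ n ≠ 1)
    (i : ℕ) (hi : 1 ≤ i)
    (nz : Ueq F q) (hnz : nz = (q / (q - q⁻¹)) • (1 - ux F q * uy F q)) :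
    uz F q * nz ^ i - nz ^ i * uz F q =
      (q ^ (1 - (i : ℤ)) * qInt F q i) • (nz ^ (i - 1) * ux F q - uy F q * nz ^ (i - 1)) := by
  have hq2 : q ^ 2 ≠ 1 := hroot 2 (by norm_num)
  have hd : q - q⁻¹ ≠ 0 := by
    intro h
    apply hq2
    field_simp at h
    linear_combination h
  have hxy := RingQuot.mkAlgHom_rel F (EqRel.xy (F := F) (q := q))
  have hyz := RingQuot.mkAlgHom_rel F (EqRel.yz (F := F) (q := q))
  have hzx := RingQuot.mkAlgHom_rel F (EqRel.zx (F := F) (q := q))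
  simp only [map_smul, map_sub, map_mul, map_one] at hxy hyz hzx
  obtain ⟨h1, h2, h3⟩ := aux_base F q hq hd (ux F q) (uy F q) (uz F q) nz hxy hyz hzx hnz
  obtain ⟨k, rfl⟩ : ∃ k, i = k + 1 := ⟨i - 1, by omega⟩
  rw [aux_ind F (q⁻¹ ^ 2) _ _ _ _ h1 h2 h3 k, Nat.add_sub_cancel]
  congr 1
  have hp : q⁻¹ ^ 2 ≠ 1 := by
    rw [inv_pow]; simpa using hq2
  rw [geom_sum_eq hp]
  have e1 : q ^ (1 - ((k + 1 : ℕ) : ℤ)) = (q ^ k)⁻¹ := by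
    rw [← zpow_natCast, ← zpow_neg]; congr 1; push_cast; ring
  have hd2 : q⁻¹ ^ 2 - 1 ≠ 0 := sub_ne_zero.mpr hp
  rw [e1, qInt, zpow_neg, zpow_natCast, ← mul_div_assoc, div_eq_div_iff hd2 hd]
  simp only [inv_pow]
  field_simp
  ring

end Lusztig
end

section
/- Let V be a nonzero finite-dimensional F-vector space, and let x, y, z ∈ End(V) with y invertible satisfy q x y − q⁻¹ y x = (q − q⁻¹)·1, q y z − q⁻¹ z y = (q − q⁻¹)·1, q z x − q⁻¹ x z = (q − q⁻¹)·1. Set n_x = q(1 − y z)/(q − q⁻¹), n_y = q(1 − z x)/(q − q⁻¹), n_z = q(1 − x y)/(q − q⁻¹), and assume n_z is nilpotent and x is invertible. Then exp_q(n_z)⁻¹ ∘ n_x ∘ exp_q(n_z) = x⁻¹ n_y x⁻¹. -/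
namespace Lusztig

variable (F : Type*) [Field F] (q : F)



section helpers

theorem aux_pow_ne {F : Type*} [Field F] {q : F} (hroot : ∀ n : ℕ, 0 < n → q ^ n ≠ 1) (n : ℕ) :
    (q ^ 2) ^ (n + 1) - 1 ≠ 0 := by
  rw [← pow_mul]
  exact sub_ne_zero.mpr (hroot _ (by positivity))

theorem aux_qInt {F : Type*} [Field F] {q : F} (hq : q ≠ 0)
    (hroot : ∀ n : ℕ, 0 < n → q ^ n ≠ 1) (i : ℕ) :
    qInt F q ((i : ℤ) + 1) * (q ^ 2 - 1) * q ^ i = (q ^ 2) ^ (i + 1) - 1 := by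
  have h1 : q ^ 2 - 1 ≠ 0 := sub_ne_zero.mpr (hroot 2 (by norm_num))
  have h3 : q - q⁻¹ ≠ 0 := by
    intro h
    apply h1
    field_simp at h
    simpa using h
  have h2 : q ^ ((i : ℤ) + 1) = q ^ (i + 1) := by exact_mod_cast zpow_natCast q (i + 1)
  unfold qInt
  rw [zpow_neg, h2]
  have : q - q⁻¹ = (q ^ 2 - 1) / q := by field_simp
  rw [this]
  field_simp
  ring

theorem aux_qInt_ne {F : Type*} [Field F] {q : F} (hq : q ≠ 0)
    (hroot : ∀ n : ℕ, 0 < n → q ^ n ≠ 1) (i : ℕ) : qInt F q ((i : ℤ) + 1) ≠ 0 := by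
  intro h
  have := aux_qInt hq hroot i
  rw [h] at this
  exact aux_pow_ne hroot i (by rw [← this]; ring)

theorem aux_qFact_ne {F : Type*} [Field F] {q : F} (hq : q ≠ 0)
    (hroot : ∀ n : ℕ, 0 < n → q ^ n ≠ 1) (i : ℕ) : qFact F q i ≠ 0 := by
  unfold qFact
  exact Finset.prod_ne_zero_iff.mpr fun j _ => aux_qInt_ne hq hroot j

theorem aux_a {F : Type*} [Field F] {q : F} (hq : q ≠ 0)
    (hroot : ∀ n : ℕ, 0 < n → q ^ n ≠ 1) (i : ℕ) :
    (q ^ ((i + 1).choose 2) / qFact F q (i + 1)) * ((q ^ 2) ^ (i + 1) - 1)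
      = (q ^ 2 - 1) * (q ^ 2) ^ i * (q ^ (i.choose 2) / qFact F q i) := by
  have h1 := aux_qInt_ne hq hroot i
  have h2 := aux_qFact_ne hq hroot i
  have h3 : qFact F q (i + 1) = qFact F q i * qInt F q ((i : ℤ) + 1) := by
    unfold qFact
    rw [Finset.prod_range_succ]
  have h4 : (i + 1).choose 2 = i + i.choose 2 := by
    rw [Nat.choose_succ_succ' i 1, Nat.choose_one_right]
  rw [h3, h4, ← aux_qInt hq hroot i]
  field_simp
  ring

theorem aux_b {F : Type*} [Field F] {q : F} (hq : q ≠ 0)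
    (hroot : ∀ n : ℕ, 0 < n → q ^ n ≠ 1) (i : ℕ) :
    (((-1 : F) ^ (i + 1) * (q ^ ((i + 1).choose 2))⁻¹) / qFact F q (i + 1))
        * ((q ^ 2) ^ (i + 1) - 1)
      = - ((q ^ 2 - 1) * (((-1 : F) ^ i * (q ^ (i.choose 2))⁻¹) / qFact F q i)) := by
  have h1 := aux_qInt_ne hq hroot i
  have h2 := aux_qFact_ne hq hroot i
  have h3 : qFact F q (i + 1) = qFact F q i * qInt F q ((i : ℤ) + 1) := by
    unfold qFact
    rw [Finset.prod_range_succ]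
  have h4 : (i + 1).choose 2 = i + i.choose 2 := by
    rw [Nat.choose_succ_succ' i 1, Nat.choose_one_right]
  rw [h3, h4, ← aux_qInt hq hroot i]
  field_simp
  ring

theorem aux_conv {F : Type*} [Field F] {p : F} (hp : ∀ n : ℕ, p ^ (n + 1) - 1 ≠ 0)
    (a b : ℕ → F)
    (ha : ∀ i, a (i + 1) * (p ^ (i + 1) - 1) = (p - 1) * p ^ i * a i)
    (hb : ∀ i, b (i + 1) * (p ^ (i + 1) - 1) = - ((p - 1) * b i)) (k : ℕ) :
    ∑ t ∈ Finset.HasAntidiagonal.antidiagonal (k + 1), b t.1 * a t.2 = 0 := by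
  apply (mul_eq_zero.mp _).resolve_left (hp k)
  rw [Finset.mul_sum]
  have h : ∀ t ∈ Finset.HasAntidiagonal.antidiagonal (k + 1), (p ^ (k + 1) - 1) * (b t.1 * a t.2)
      = b t.1 * (a t.2 * (p ^ t.2 - 1)) + (b t.1 * (p ^ t.1 - 1)) * (p ^ t.2 * a t.2) := by
    intro t ht
    rw [Finset.HasAntidiagonal.mem_antidiagonal] at ht
    rw [← ht, pow_add]
    ring
  rw [Finset.sum_congr rfl h, Finset.sum_add_distrib, Finset.Nat.sum_antidiagonal_succ',
    Finset.Nat.sum_antidiagonal_succ (f := fun t => (b t.1 * (p ^ t.1 - 1)) * (p ^ t.2 * a t.2))]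
  simp only [ha, hb, pow_zero, sub_self, mul_zero, zero_mul, add_zero, zero_add]
  rw [← Finset.sum_add_distrib]
  apply Finset.sum_eq_zero
  intro t _
  ring

theorem aux_inv_s14 {F A : Type*} [Field F] [Ring A] [Algebra F A] (a b : ℕ → F)
    (h0 : b 0 * a 0 = 1)
    (hc : ∀ k, ∑ t ∈ Finset.HasAntidiagonal.antidiagonal (k + 1), b t.1 * a t.2 = 0) (n : A) (d : ℕ)
    (hn : n ^ d = 0) :
    (∑ i ∈ Finset.range (d + 1), b i • n ^ i) * (∑ i ∈ Finset.range (d + 1), a i • n ^ i) = 1 := by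
  classical
  let P : (ℕ → F) → Polynomial F := fun a =>
    ∑ i ∈ Finset.range (d + 1), Polynomial.monomial i (a i)
  have hP : ∀ a : ℕ → F, Polynomial.aeval n (P a) = ∑ i ∈ Finset.range (d + 1), a i • n ^ i := by
    intro a
    simp [P, Polynomial.aeval_monomial, Algebra.smul_def]
  have hPc : ∀ (a : ℕ → F) (m : ℕ), m < d + 1 → (P a).coeff m = a m := by
    intro a m hm
    simp only [P, Polynomial.finsetSum_coeff, Polynomial.coeff_monomial]
    rw [Finset.sum_ite_eq' (Finset.range (d + 1)) m a]
    simp [hm]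
  have hdvd : Polynomial.X ^ (d + 1) ∣ P b * P a - 1 := by
    rw [Polynomial.X_pow_dvd_iff]
    intro m hm
    rw [Polynomial.coeff_sub, Polynomial.coeff_mul]
    have : ∑ t ∈ Finset.HasAntidiagonal.antidiagonal m, (P b).coeff t.1 * (P a).coeff t.2
        = ∑ t ∈ Finset.HasAntidiagonal.antidiagonal m, b t.1 * a t.2 := by
      apply Finset.sum_congr rfl
      intro t ht
      rw [Finset.HasAntidiagonal.mem_antidiagonal] at ht
      rw [hPc _ _ (by omega), hPc _ _ (by omega)]
    rw [this]
    cases m with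
    | zero => simp [h0]
    | succ k => rw [hc k]; simp [Polynomial.coeff_one]
  obtain ⟨R, hR⟩ := hdvd
  have h := congrArg (Polynomial.aeval n) hR
  simp only [map_sub, map_mul, map_one, map_pow, Polynomial.aeval_X, hP] at h
  rw [pow_succ, hn, zero_mul, zero_mul] at h
  exact sub_eq_zero.mp h

theorem aux_yEx {F A : Type*} [Field F] [Ring A] [Algebra F A] {p : F} (a : ℕ → F)
    (ha : ∀ i, a (i + 1) * (p ^ (i + 1) - 1) = (p - 1) * p ^ i * a i)
    (x y n : A) (hyx : y * x = 1 - (p - 1) • n) (hyn : y * n = p • (n * y)) (d : ℕ) :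
    y * (∑ i ∈ Finset.range (d + 1), a i • n ^ i) * x
      = ∑ i ∈ Finset.range (d + 1), a i • n ^ i - (p ^ d * a d * (p - 1)) • n ^ (d + 1) := by
  have hyni : ∀ i, y * n ^ i = p ^ i • (n ^ i * y) := by
    intro i
    induction i with
    | zero => simp
    | succ i ih =>
      rw [pow_succ, ← mul_assoc, ih, smul_mul_assoc, mul_assoc, hyn, mul_smul_comm, smul_smul,
        pow_succ p, ← mul_assoc]
  have hk : ∀ i, y * n ^ i * x = p ^ i • n ^ i - (p ^ i * (p - 1)) • n ^ (i + 1) := by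
    intro i
    rw [hyni, smul_mul_assoc, mul_assoc, hyx, mul_sub, mul_one, mul_smul_comm, ← pow_succ, smul_sub,
      smul_smul]
  induction d with
  | zero =>
    have := hk 0
    simp only [pow_zero, mul_one, one_mul, one_smul, zero_add, pow_one] at this
    simp [this, smul_sub, smul_smul]
  | succ d ih =>
    rw [Finset.sum_range_succ, mul_add, add_mul, ih, mul_smul_comm, smul_mul_assoc, hk]
    have := ha d
    have h2 : a (d + 1) * p ^ (d + 1) = a (d + 1) + p ^ d * a d * (p - 1) := by
      linear_combination this
    rw [smul_sub, smul_smul, h2, add_smul, smul_smul]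
    have h3 : a (d + 1) * (p ^ (d + 1) * (p - 1)) = p ^ (d + 1) * a (d + 1) * (p - 1) := by ring
    rw [h3]
    abel

theorem aux_zE {F A : Type*} [Field F] [Ring A] [Algebra F A] {p : F} (hp0 : p ≠ 0)
    (hp : p - 1 ≠ 0) (a : ℕ → F)
    (ha : ∀ i, a (i + 1) * (p ^ (i + 1) - 1) = (p - 1) * p ^ i * a i)
    (x y z n : A) (hnx : x * n = p⁻¹ • (n * x)) (hyn : n * y = p⁻¹ • (y * n))
    (hzn : z * n = n * z + x - y) (d : ℕ) :
    z * (∑ i ∈ Finset.range (d + 1), a i • n ^ i)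
      = (∑ i ∈ Finset.range (d + 1), a i • n ^ i) * z
        + (∑ i ∈ Finset.range (d + 1), a i • n ^ i) * x
        - y * (∑ i ∈ Finset.range (d + 1), a i • n ^ i)
        - a d • (n ^ d * x) + a d • (y * n ^ d) := by
  have hyni : ∀ i, n ^ i * y = (p ^ i)⁻¹ • (y * n ^ i) := by
    intro i
    induction i with
    | zero => simp
    | succ i ih =>
      rw [pow_succ, mul_assoc, hyn, mul_smul_comm, ← mul_assoc, ih, smul_mul_assoc, smul_smul,
        pow_succ p, mul_inv, mul_comm p⁻¹, mul_assoc]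
  let t : ℕ → F := fun i => (p ^ (i + 1) - 1) / ((p - 1) * p ^ i)
  have ht1 : ∀ i, t (i + 1) = 1 + p⁻¹ * t i := by
    intro i
    simp only [t]
    field_simp
    ring
  have ht2 : ∀ i, t (i + 1) = (p ^ (i + 1))⁻¹ + t i := by
    intro i
    simp only [t]
    field_simp
    ring
  have hk : ∀ i, z * n ^ (i + 1) = n ^ (i + 1) * z + t i • (n ^ i * x) - t i • (y * n ^ i) := by
    intro i
    induction i with
    | zero =>
      have : t 0 = 1 := by simp [t, hp]
      simp [this, hzn]
    | succ i ih =>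
      have e1 : n ^ (i + 1) * y = (p ^ (i + 1))⁻¹ • (y * n ^ (i + 1)) := hyni (i + 1)
      have e2 : n ^ i * x * n = p⁻¹ • (n ^ (i + 1) * x) := by
        rw [mul_assoc, hnx, mul_smul_comm, ← mul_assoc, ← pow_succ]
      calc z * n ^ (i + 1 + 1) = (z * n ^ (i + 1)) * n := by rw [pow_succ _ (i + 1), mul_assoc]
        _ = n ^ (i + 1) * (z * n) + t i • (n ^ i * x * n) - t i • (y * n ^ (i + 1)) := by
          rw [ih, sub_mul, add_mul, smul_mul_assoc, smul_mul_assoc, mul_assoc, mul_assoc y,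
            ← pow_succ]
        _ = n ^ (i + 1 + 1) * z + (1 + p⁻¹ * t i) • (n ^ (i + 1) * x)
            - ((p ^ (i + 1))⁻¹ + t i) • (y * n ^ (i + 1)) := by
          rw [hzn, mul_sub, mul_add, e1, e2, ← mul_assoc, ← pow_succ]
          module
        _ = _ := by rw [← ht1, ← ht2]
  have hat : ∀ i, a (i + 1) * t i = a i := by
    intro i
    simp only [t]
    rw [← mul_div_assoc, ha]
    field_simp
  induction d with
  | zero => simp; abel
  | succ d ih =>
    rw [Finset.sum_range_succ, mul_add, ih, mul_smul_comm, hk, smul_sub, smul_add, smul_smul,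
      smul_smul, hat]
    simp only [add_mul, mul_add, smul_mul_assoc, mul_smul_comm]
    abel

end helpers

/-- exp_q(n_z)⁻¹ ∘ n_x ∘ exp_q(n_z) = x⁻¹ n_y x⁻¹. -/
theorem stmt14 (hq : q ≠ 0) (hroot : ∀ n : ℕ, 0 < n → q ^ n ≠ 1)
    (V : Type*) [AddCommGroup V] [Module F V] [FiniteDimensional F V] [Nontrivial V]
    (x y z : Module.End F V) (hy : IsUnit y)
    (hxy : q • (x * y) - q⁻¹ • (y * x) = (q - q⁻¹) • (1 : Module.End F V))
    (hyz : q • (y * z) - q⁻¹ • (z * y) = (q - q⁻¹) • (1 : Module.End F V))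
    (hzx : q • (z * x) - q⁻¹ • (x * z) = (q - q⁻¹) • (1 : Module.End F V))
    (nx ny nz : Module.End F V)
    (hnx : nx = (q / (q - q⁻¹)) • (1 - y * z))
    (hny : ny = (q / (q - q⁻¹)) • (1 - z * x))
    (hnz : nz = (q / (q - q⁻¹)) • (1 - x * y))
    (hnil : IsNilpotent nz) (hx : IsUnit x) :
    expqInv F q nz * nx * expq F q nz = Ring.inverse x * ny * Ring.inverse x := by
  classical
  have hp0 : q ^ 2 ≠ 0 := pow_ne_zero _ hq
  have hp : q ^ 2 - 1 ≠ 0 := sub_ne_zero.mpr (hroot 2 (by norm_num))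
  have hc : q / (q - q⁻¹) = q ^ 2 / (q ^ 2 - 1) := by
    have : q - q⁻¹ = (q ^ 2 - 1) / q := by field_simp
    rw [this]
    field_simp
  have key : ∀ u v : Module.End F V, q • u - q⁻¹ • v = (q - q⁻¹) • (1 : Module.End F V) →
      v = q ^ 2 • u - (q ^ 2 - 1) • (1 : Module.End F V) := by
    intro u v h
    have h' := congrArg (fun w => q • w) h
    simp only [smul_sub, smul_smul, mul_inv_cancel₀ hq, one_smul, sub_smul] at h'
    rw [sub_smul, one_smul, pow_two]
    rw [sub_eq_iff_eq_add] at h'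
    rw [h']
    abel
  have hyx := key _ _ hxy
  have hzy := key _ _ hyz
  have hxz := key _ _ hzx
  rw [hc] at hnx hny hnz
  obtain ⟨p, hpq⟩ : ∃ p, p = q ^ 2 := ⟨_, rfl⟩
  have hxyn : x * y = 1 - ((p - 1) / p) • nz := by
    rw [hnz, smul_smul, ← hpq, div_mul_div_cancel₀ (by rw [hpq]; exact hp0),
      div_self (by rw [hpq]; exact hp), one_smul]
    abel
  rw [← hpq] at hp0 hp hyx hzy hxz hnx hny hnz
  have hyxn : y * x = 1 - (p - 1) • nz := by
    rw [hyx, hxyn, smul_sub, smul_smul, mul_div_cancel₀ _ hp0]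
    module
  have hnzx : x * nz = p⁻¹ • (nz * x) := by
    have h : x * (y * x) = (x * y) * x := (mul_assoc _ _ _).symm
    rw [hxyn, hyxn, mul_sub, sub_mul, mul_one, one_mul, sub_right_inj, mul_smul_comm,
      smul_mul_assoc, div_eq_mul_inv, mul_smul] at h
    exact smul_right_injective _ hp h
  have hnzy : nz * y = p⁻¹ • (y * nz) := by
    have h : y * (x * y) = (y * x) * y := (mul_assoc _ _ _).symm
    rw [hxyn, hyxn, mul_sub, sub_mul, mul_one, one_mul, sub_right_inj, mul_smul_comm,
      smul_mul_assoc, div_eq_mul_inv, mul_smul] at h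
    exact (smul_right_injective _ hp h).symm
  have hynz : y * nz = p • (nz * y) := by
    rw [hnzy, smul_smul, mul_inv_cancel₀ hp0, one_smul]
  have hznz : z * nz = nz * z + x - y := by
    have h1 : x * (z * y) = (x * z) * y := (mul_assoc _ _ _).symm
    rw [hzy, hxz, mul_sub, sub_mul, mul_smul_comm, mul_smul_comm, smul_mul_assoc, smul_mul_assoc,
      mul_one, one_mul, mul_assoc z, ← mul_assoc x] at h1
    have h2 : z * (x * y) = x * y * z - ((p - 1) / p) • x + ((p - 1) / p) • y := by
      apply smul_right_injective _ hp0
      simp only [smul_add, smul_sub, smul_smul, mul_div_cancel₀ _ hp0]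
      rw [h1]
      abel
    rw [hxyn] at h2
    have hs : (p - 1) / p ≠ 0 := div_ne_zero hp hp0
    apply smul_right_injective _ hs
    simp only [mul_sub, sub_mul, mul_one, one_mul, mul_smul_comm, smul_mul_assoc] at h2
    simp only [smul_add, smul_sub]
    have h3 : ((p - 1) / p) • (z * nz) = z - (z - ((p - 1) / p) • (z * nz)) := by abel
    rw [h3, h2]
    abel
  have hnd : nz ^ Module.finrank F V = 0 := by
    have h := LinearMap.aeval_self_charpoly nz
    rw [IsNilpotent.charpoly_eq_X_pow_finrank hnil] at h
    simpa using h
  have ha := aux_a hq hroot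
  have hb := aux_b hq hroot
  have hpn := aux_pow_ne hroot
  rw [← hpq] at ha hb hpn
  have hGE : expqInv F q nz * expq F q nz = 1 := by
    refine aux_inv_s14 _ _ ?_ (aux_conv hpn (fun i => q ^ (i.choose 2) / qFact F q i) (fun i =>
      (((-1 : F) ^ i * (q ^ (i.choose 2))⁻¹) / qFact F q i)) ha hb) nz _ hnd
    simp [qFact]
  have hE1 : y * expq F q nz * x = expq F q nz := by
    have := aux_yEx (fun i => q ^ (i.choose 2) / qFact F q i) ha x y nz hyxn hynz
      (Module.finrank F V)
    rw [pow_succ, hnd, zero_mul, smul_zero, sub_zero] at this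
    exact this
  have hE2 : z * expq F q nz = expq F q nz * z + expq F q nz * x - y * expq F q nz := by
    have := aux_zE hp0 hp (fun i => q ^ (i.choose 2) / qFact F q i) ha x y z nz hnzx hnzy hznz
      (Module.finrank F V)
    rw [hnd, zero_mul, mul_zero, smul_zero, sub_zero, add_zero] at this
    exact this
  generalize expqInv F q nz = G at *
  generalize expq F q nz = E at *
  have hxi := Ring.mul_inverse_cancel x hx
  generalize Ring.inverse x = xi at *
  have hE3 : y * E = E * xi := by
    rw [← hE1, mul_assoc _ x, hxi, mul_one, hE1]
  have h4 : nx * E = E * (xi * ny * xi) := by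
    rw [hnx, hny, smul_mul_assoc, mul_smul_comm, smul_mul_assoc, mul_smul_comm]
    congr 1
    have e1 : xi * (1 - z * x) * xi = xi * xi - xi * z := by
      rw [mul_sub, sub_mul, mul_one, mul_assoc xi (z * x), mul_assoc z, hxi, mul_one]
    rw [e1, sub_mul, one_mul, mul_assoc, hE2, mul_sub, mul_add, ← mul_assoc, ← mul_assoc, hE1, hE3,
      ← mul_assoc, hE3, mul_sub, ← mul_assoc, ← mul_assoc]
    abel
  rw [mul_assoc, h4, ← mul_assoc, hGE, one_mul]

end Lusztig
end
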